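/- arXiv:1208.0985 — 3 statements merged into one kernel-verified Lean document; each statement's English description precedes it below -/
import Mathlib

section
/- Let f be a Brouwer homeomorphism (fixed point free, orientation preserving homeomorphism of ℝ²). For every compact set K ⊆ ℝ², there is a compact set C containing K ∪ f⁻¹(K) such that every point x outside C ∪ f⁻¹(C) admits a translation arc γ for f with γ ∩ K = ∅. -/
def OrientationPreserving {X : Type*} [TopologicalSpace X] (f : X ≃ₜ X) : Prop :=
  ∃ F : ℝ → X ≃ₜ X, (Continuous fun p : ℝ × X => F p.1 p.2) ∧
    F 0 = Homeomorph.refl X ∧ F 1 = f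

/-- A translation arc for `f` at `x`: a simple arc from `x` to `f x` meeting its image
only at `f x`. -/
def TranslationArc (f : ℂ ≃ₜ ℂ) (x : ℂ) (γ : C(unitInterval, ℂ)) : Prop :=
  Function.Injective γ ∧ γ 0 = x ∧ γ 1 = f x ∧
  Set.range γ ∩ f '' Set.range γ = {γ 1}

open Set

section Logarithm

variable {X : Type*} [TopologicalSpace X]

/-- A nowhere vanishing continuous function on a simply connected, locally path connected space
has a continuous logarithm. -/
theorem exists_continuous_exp_eq [SimplyConnectedSpace X] [LocallyPathConnectedSpace X]
    {g : X → ℂ} (hg : Continuous g) (h0 : ∀ x, g x ≠ 0) :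
    ∃ u : X → ℂ, Continuous u ∧ ∀ x, Complex.exp (u x) = g x := by
  obtain ⟨a⟩ : Nonempty X := inferInstance
  obtain ⟨u, ⟨-, hu⟩, -⟩ := Complex.isCoveringMap_exp.existsUnique_continuousMap_lifts
    ⟨fun x => (⟨g x, h0 x⟩ : {z : ℂ // z ≠ 0}), by fun_prop⟩ a (Complex.log (g a))
    (Subtype.ext (Complex.exp_log (h0 a)))
  exact ⟨u, u.continuous, fun x => congrArg Subtype.val (congrFun hu x)⟩

/-- Two continuous logarithms of proportional functions differ by a constant. -/
theorem sub_eq_sub_of_exp_eq_mul_exp [PreconnectedSpace X] {u v : X → ℂ} (hu : Continuous u)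
    (hv : Continuous v) {k : ℂ} (h : ∀ x, Complex.exp (u x) = k * Complex.exp (v x)) (x y : X) :
    u x - v x = u y - v y := by
  refine Complex.isCoveringMap_exp.const_of_comp (g := fun x => u x - v x) (hu.sub hv) ?_ x y
  intro a b
  simp [Complex.exp_sub, h, Complex.exp_ne_zero]

end Logarithm

/-- If a path is disjoint from its image under a Brouwer homeomorphism `f`, then `f ∘ f` does not
map its origin to its end. -/
theorem OrientationPreserving.apply_apply_ne_of_path {f : ℂ ≃ₜ ℂ} (hor : OrientationPreserving f)
    (hfree : ∀ x, f x ≠ x) {c : ℝ → ℂ} (hc : Continuous c) (hdisj : ∀ s t, f (c s) ≠ c t) :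
    f (f (c 0)) ≠ c 1 := by
  intro hend
  obtain ⟨F, hF, hF0, hF1⟩ := hor
  have hFc {Y : Type} [TopologicalSpace Y] {a : Y → ℝ} {b : Y → ℂ} (ha : Continuous a)
      (hb : Continuous b) : Continuous fun y => F (a y) (b y) := hF.comp (ha.prodMk hb)
  have F0 (z : ℂ) : F 0 z = z := by simp [hF0]
  have F1 (z : ℂ) : F 1 z = f z := by rw [hF1]
  have hfc := f.continuous
  obtain ⟨U, hU, eU⟩ := exists_continuous_exp_eq (X := ℝ × ℂ)
    (g := fun p => F p.1 (f p.2) - F p.1 p.2)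
    ((hFc (by fun_prop) (by fun_prop)).sub (hFc (by fun_prop) (by fun_prop)))
    fun p => sub_ne_zero.2 fun h => hfree _ ((F p.1).injective h)
  obtain ⟨V, hV, eV⟩ := exists_continuous_exp_eq (X := ℝ × ℝ)
    (g := fun p => F p.1 (c p.2) - F p.1 (f (c 0)))
    ((hFc (by fun_prop) (by fun_prop)).sub (hFc (by fun_prop) (by fun_prop)))
    fun p => sub_ne_zero.2 fun h => hdisj _ _ ((F p.1).injective h).symm
  obtain ⟨W, hW, eW⟩ := exists_continuous_exp_eq (X := ℝ × ℝ)
    (g := fun p => f (c p.1) - c p.2) (by fun_prop) fun p => sub_ne_zero.2 (hdisj _ _)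
  have h₁ := sub_eq_sub_of_exp_eq_mul_exp (k := 1) (u := fun t : ℝ => U (t, f (c 0)))
    (v := fun t => V (t, 1)) (by fun_prop) (by fun_prop) (by simp [eU, eV, hend]) 0 1
  have h₂ := sub_eq_sub_of_exp_eq_mul_exp (k := -1) (u := fun t : ℝ => U (t, c 0))
    (v := fun t => V (t, 0)) (by fun_prop) (by fun_prop) (by simp [eU, eV]) 0 1
  have h₃ := sub_eq_sub_of_exp_eq_mul_exp (k := 1) (u := fun z : ℂ => U (1, z))
    (v := fun z => U (0, f z)) (by fun_prop) (by fun_prop) (by simp [eU, F0, F1]) (c 0) (f (c 0))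
  have h₄ := sub_eq_sub_of_exp_eq_mul_exp (k := 1) (u := fun s : ℝ => U (0, c s))
    (v := fun s => W (s, s)) (by fun_prop) (by fun_prop) (by simp [eU, eW, F0]) 0 1
  have h₅ := sub_eq_sub_of_exp_eq_mul_exp (k := 1) (u := fun s : ℝ => V (1, s))
    (v := fun s => W (s, 1)) (by fun_prop) (by fun_prop) (by simp [eV, eW, F1, hend]) 0 1
  have h₆ := sub_eq_sub_of_exp_eq_mul_exp (k := -1) (u := fun s : ℝ => V (0, s))
    (v := fun s => W (0, s)) (by fun_prop) (by fun_prop) (by simp [eV, eW, F0]) 0 1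
  have h₇ : U (0, f (c 0)) - V (0, 1) = U (0, c 0) - V (0, 0) := by
    simp only [hend] at h₁ h₂ h₃ h₄ h₅ h₆
    linear_combination (h₁ - h₂ - h₃ - h₄ + h₅ + h₆) / 2
  have h₈ : Complex.exp (U (0, f (c 0)) - V (0, 1)) = 1 := by
    rw [Complex.exp_sub, eU, eV]
    simp only [F0, hend]
    exact div_self (sub_ne_zero.2 (hdisj 0 1).symm)
  have h₉ : Complex.exp (U (0, c 0) - V (0, 0)) = -1 := by
    rw [Complex.exp_sub, eU, eV]
    simp only [F0]
    rw [← neg_sub, neg_div, div_self (sub_ne_zero.2 (hdisj 0 0).symm)]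
  rw [h₇, h₉] at h₈
  norm_num at h₈

/-- The concatenation of two arcs that only share the expected endpoint is an arc. -/
theorem exists_arc_trans {X : Type*} [TopologicalSpace X] {β δ : ℝ → X} (hβ : Continuous β)
    (hδ : Continuous δ) (h : β 1 = δ 0) (iβ : InjOn β (Icc 0 1)) (iδ : InjOn δ (Icc 0 1))
    (hd : ∀ s ∈ Icc (0 : ℝ) 1, ∀ t ∈ Icc (0 : ℝ) 1, β s = δ t → t = 0) :
    ∃ γ : C(unitInterval, X), Function.Injective γ ∧ γ 0 = β 0 ∧ γ 1 = δ 1 ∧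
      ∀ t, γ t ∈ β '' Icc 0 1 ∪ δ '' Icc 0 1 := by
  have hmem (t : unitInterval) : (t : ℝ) ≤ 1 / 2 → 2 * (t : ℝ) ∈ Icc (0 : ℝ) 1 := fun ht =>
    ⟨by linarith [t.2.1], by linarith⟩
  have hmem' (t : unitInterval) : ¬ (t : ℝ) ≤ 1 / 2 → 2 * (t : ℝ) - 1 ∈ Icc (0 : ℝ) 1 := fun ht =>
    ⟨by linarith, by linarith [t.2.2]⟩
  let γ : C(unitInterval, X) :=
    ⟨fun t => if (t : ℝ) ≤ 1 / 2 then β (2 * t) else δ (2 * t - 1),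
      Continuous.if_le (by fun_prop) (by fun_prop) (by fun_prop) (by fun_prop)
        fun t ht => by simp [ht, h]⟩
  have hγ (t : unitInterval) :
    γ t = if (t : ℝ) ≤ 1 / 2 then β (2 * t) else δ (2 * t - 1) := rfl
  refine ⟨γ, fun s t hst => ?_, by simp [hγ], ?_, fun t => ?_⟩
  · rw [hγ, hγ] at hst
    apply Subtype.ext
    split_ifs at hst with h₁ h₂ h₂
    · linarith [iβ (hmem s h₁) (hmem t h₂) hst]
    · linarith [hd _ (hmem s h₁) _ (hmem' t h₂) hst]
    · linarith [hd _ (hmem t h₂) _ (hmem' s h₁) hst.symm]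
    · linarith [iδ (hmem' s h₁) (hmem' t h₂) hst]
  · norm_num [hγ]
  · rw [hγ]
    split_ifs with h₁
    · exact .inl (mem_image_of_mem _ (hmem t h₁))
    · exact .inr (mem_image_of_mem _ (hmem' t h₁))

section CriticalDisk

variable {E : Type*} [NormedAddCommGroup E] [NormedSpace ℝ E]

theorem dist_lineMap_lt {x z : E} (h : z ≠ x) {s : ℝ} (hs : s ∈ Icc (0 : ℝ) 1) (h1 : s ≠ 1) :
    dist (AffineMap.lineMap x z s) x < dist z x := by
  rw [dist_lineMap_left, Real.norm_of_nonneg hs.1, dist_comm x z]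
  exact mul_lt_of_lt_one_left (dist_pos.2 h) (lt_of_le_of_ne hs.2 h1)

theorem dist_lineMap_le (x z : E) {s : ℝ} (hs : s ∈ Icc (0 : ℝ) 1) :
    dist (AffineMap.lineMap x z s) x ≤ dist z x := by
  rw [dist_lineMap_left, Real.norm_of_nonneg hs.1, dist_comm x z]
  exact mul_le_of_le_one_left dist_nonneg hs.2

/-- In a chart `φ` containing a point and its image under `f` there is a critical disk: a ball
disjoint from its image such that the closed ball and its image meet, and only in boundary
points. -/
theorem exists_critical_ball [ProperSpace E] {Y : Type*} [TopologicalSpace Y] [T2Space Y]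
    (f : Y ≃ₜ Y) (hfree : ∀ y, f y ≠ y) {φ : E → Y} (hφ : Continuous φ) (hopen : IsOpenMap φ)
    {x y : E} (hxy : f (φ x) = φ y) :
    ∃ r > 0, ∃ w z : E, dist w x = r ∧ dist z x = r ∧ f (φ w) = φ z ∧
      ∀ a b, dist a x ≤ r → dist b x ≤ r → f (φ a) = φ b → dist a x = r ∧ dist b x = r := by
  have hcl : IsClosed {p : E × E | f (φ p.1) = φ p.2} := isClosed_eq (by fun_prop) (by fun_prop)
  obtain ⟨p, hp, hmin⟩ := hcl.exists_infDist_eq_dist ⟨(x, y), hxy⟩ (x, x)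
  set r := dist (x, x) p with hr
  have hle (a b : E) (hab : f (φ a) = φ b) : r ≤ max (dist a x) (dist b x) := by
    rw [← hmin, dist_comm a, dist_comm b, ← Prod.dist_eq (x := (x, x)) (y := (a, b))]
    exact Metric.infDist_le_dist_of_mem hab
  have hr0 : 0 < r := by
    refine dist_pos.2 fun h => hfree (φ x) ?_
    rw [← h] at hp
    exact hp
  have hbd (a b : E) (ha : dist a x ≤ r) (hb : dist b x ≤ r) (hab : f (φ a) = φ b) :
      dist a x = r ∧ dist b x = r := by
    constructor
    · refine ha.antisymm (not_lt.1 fun hlt => ?_)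
      have hO : IsOpen (φ ⁻¹' (f '' (φ '' Metric.ball x r))) :=
        (f.isOpenMap _ (hopen _ Metric.isOpen_ball)).preimage hφ
      have hbO : b ∈ φ ⁻¹' (f '' (φ '' Metric.ball x r)) := ⟨φ a, ⟨a, hlt, rfl⟩, hab⟩
      rw [← Metric.mem_closedBall, ← closure_ball x hr0.ne'] at hb
      obtain ⟨b', ⟨_, ⟨a', ha', rfl⟩, h⟩, hb'⟩ := mem_closure_iff.1 hb _ hO hbO
      exact (hle a' b' h).not_gt (max_lt ha' hb')
    · refine hb.antisymm (not_lt.1 fun hlt => ?_)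
      have hO : IsOpen ((fun a => f (φ a)) ⁻¹' (φ '' Metric.ball x r)) :=
        (hopen _ Metric.isOpen_ball).preimage (by fun_prop)
      have haO : a ∈ (fun a => f (φ a)) ⁻¹' (φ '' Metric.ball x r) := ⟨b, hlt, hab.symm⟩
      rw [← Metric.mem_closedBall, ← closure_ball x hr0.ne'] at ha
      obtain ⟨a', ⟨b', hb', h⟩, ha'⟩ := mem_closure_iff.1 ha _ hO haO
      exact (hle a' b' h.symm).not_gt (max_lt ha' hb')
  have hp' : dist p.1 x ≤ r ∧ dist p.2 x ≤ r := by
    rw [hr, dist_comm _ p, Prod.dist_eq]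
    exact ⟨le_max_left _ _, le_max_right _ _⟩
  obtain ⟨h₁, h₂⟩ := hbd _ _ hp'.1 hp'.2 hp
  exact ⟨r, hr0, p.1, p.2, h₁, h₂, hp, hbd⟩

/-- A Brouwer homeomorphism has no point of a disk `D` with second iterate in `D`, if `D` is
disjoint from its image. -/
theorem OrientationPreserving.apply_apply_ne_of_ball {f : ℂ ≃ₜ ℂ} (hor : OrientationPreserving f)
    (hfree : ∀ x, f x ≠ x) {φ : E → ℂ} (hφ : Continuous φ) {x : E} {r : ℝ}
    (hdisj : ∀ a ∈ Metric.ball x r, ∀ b ∈ Metric.ball x r, f (φ a) ≠ φ b) {a b : E}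
    (ha : a ∈ Metric.ball x r) (hb : b ∈ Metric.ball x r) : f (f (φ a)) ≠ φ b := by
  let c : ℝ → E := fun s => AffineMap.lineMap a b (projIcc (0 : ℝ) 1 zero_le_one s : ℝ)
  have hc : Continuous c :=
    AffineMap.lineMap_continuous.comp (continuous_subtype_val.comp continuous_projIcc)
  have hmem (s : ℝ) : c s ∈ Metric.ball x r :=
    (convex_ball x r).segment_subset ha hb
      (segment_eq_image_lineMap ℝ a b ▸ mem_image_of_mem _ (Subtype.prop _))
  simpa [c] using hor.apply_apply_ne_of_path hfree (hφ.comp hc)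
    fun s t => hdisj _ (hmem s) _ (hmem t)

/-- A chart containing a point and its image under a Brouwer homeomorphism `f` yields a
translation arc contained in the union of the chart and its image. -/
theorem OrientationPreserving.exists_translationArc_of_chart [ProperSpace E] {f : ℂ ≃ₜ ℂ}
    (hor : OrientationPreserving f) (hfree : ∀ x, f x ≠ x) {φ : E → ℂ} (hφ : Continuous φ)
    (hopen : IsOpenMap φ) (hinj : Function.Injective φ) {x y : E} (hxy : f (φ x) = φ y) :
    ∃ γ : C(unitInterval, ℂ), TranslationArc f (φ x) γ ∧
      range γ ⊆ range φ ∪ f '' range φ := by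
  obtain ⟨r, hr, w, z, hw, hz, hwz, hbd⟩ := exists_critical_ball f hfree hφ hopen hxy
  have hfr (a : E) : f (φ a) ≠ φ a := hfree _
  have hwx : w ≠ x := dist_pos.1 (hw ▸ hr)
  have hzx : z ≠ x := dist_pos.1 (hz ▸ hr)
  have hFranks (a b : E) (ha : dist a x < r) (hb : dist b x < r) : f (f (φ a)) ≠ φ b :=
    hor.apply_apply_ne_of_ball hfree hφ
      (fun a ha b hb h => (hbd a b ha.le hb.le h).1.not_lt ha) ha hb
  let p : ℝ → E := AffineMap.lineMap x z
  let q : ℝ → E := fun s => AffineMap.lineMap x w (1 - s)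
  have hp (s) (hs : s ∈ Icc (0 : ℝ) 1) : dist (p s) x ≤ r := hz ▸ dist_lineMap_le x z hs
  have hq (s) (hs : s ∈ Icc (0 : ℝ) 1) : dist (q s) x ≤ r :=
    hw ▸ dist_lineMap_le x w ⟨sub_nonneg.2 hs.2, sub_le_self _ hs.1⟩
  have hp1 (s) (hs : s ∈ Icc (0 : ℝ) 1) : dist (p s) x = r → s = 1 := fun h =>
    by_contra fun hne => (dist_lineMap_lt hzx hs hne).ne (h.trans hz.symm)
  have hq0 (s) (hs : s ∈ Icc (0 : ℝ) 1) : dist (q s) x = r → s = 0 := fun h =>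
    by_contra fun hne => (dist_lineMap_lt hwx (s := 1 - s)
      ⟨sub_nonneg.2 hs.2, sub_le_self _ hs.1⟩ (by simpa using hne)).ne (h.trans hw.symm)
  have p0 : p 0 = x := by simp [p]
  have p1 : p 1 = z := by simp [p]
  have q0 : q 0 = w := by simp [q]
  have q1 : q 1 = x := by simp [q]
  have hpq (s t : ℝ) (hs : s ∈ Icc (0 : ℝ) 1) (ht : t ∈ Icc (0 : ℝ) 1) (h : p s = q t) :
      p s = x := by
    have hst : s = 1 - t := by
      have := congrArg (dist · x) h
      simp only [p, q, dist_lineMap_left, dist_comm x, hz, hw, Real.norm_of_nonneg hs.1,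
        Real.norm_of_nonneg (sub_nonneg.2 ht.2)] at this
      exact mul_right_cancel₀ hr.ne' this
    by_contra hne
    have hs0 : s ≠ 0 := fun h0 => hne (h0 ▸ p0)
    simp only [p, q, ← hst, AffineMap.lineMap_apply, vsub_eq_sub, vadd_eq_add,
      add_left_inj] at h
    have := sub_left_injective (smul_right_injective E hs0 h)
    exact hfr w (hwz.trans (congrArg φ this))
  have hpc : Continuous p := AffineMap.lineMap_continuous
  have hqc : Continuous q := AffineMap.lineMap_continuous.comp (by fun_prop)
  have hpi : Function.Injective p := AffineMap.lineMap_injective ℝ hzx.symm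
  have hqi : Function.Injective q :=
    (AffineMap.lineMap_injective ℝ hwx.symm).comp (sub_right_injective (b := (1 : ℝ)))
  obtain ⟨γ, γi, γ0, γ1, hγ⟩ := exists_arc_trans (β := fun s => φ (p s))
    (δ := fun s => f (φ (q s))) (by fun_prop) (by fun_prop) (by simp [p1, q0, hwz])
    (hinj.comp hpi).injOn ((f.injective.comp hinj).comp hqi).injOn
    fun s hs t ht h => hq0 t ht (hbd _ _ (hq t ht) (hp s hs) h.symm).1
  simp only [p0, q1] at γ0 γ1
  refine ⟨γ, ⟨γi, γ0, γ1, ?_⟩, ?_⟩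
  · refine Subset.antisymm ?_ ?_
    · rintro v ⟨⟨i, rfl⟩, ⟨_, ⟨j, rfl⟩, hij⟩⟩
      rw [mem_singleton_iff, γ1]
      rcases hγ i with ⟨s, hs, hi⟩ | ⟨s, hs, hi⟩ <;> rcases hγ j with ⟨t, ht, hj⟩ | ⟨t, ht, hj⟩ <;>
        simp only at hi hj <;> rw [← hi, ← hj] at hij
      · obtain ⟨h₁, h₂⟩ := hbd _ _ (hp t ht) (hp s hs) hij
        rw [hp1 s hs h₂, hp1 t ht h₁] at hij
        exact (hfr _ hij).elim
      · rcases (hp s hs).lt_or_eq with h₁ | h₁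
        · rcases (hq t ht).lt_or_eq with h₂ | h₂
          · exact (hFranks _ _ h₂ h₁ hij).elim
          · rw [hq0 t ht h₂, q0, hwz] at hij
            exact (h₁.ne (hbd _ _ hz.le (hp s hs) hij).2).elim
        · rw [hp1 s hs h₁, p1, ← hwz] at hij
          have hij := f.injective hij
          rw [hq0 t ht (hbd _ _ (hq t ht) hw.le hij).1, q0] at hij
          exact (hfr _ hij).elim
      · rw [← hi, ← hij, hpq t s ht hs (hinj (f.injective hij))]
      · have hij := f.injective hij
        obtain ⟨h₁, h₂⟩ := hbd _ _ (hq t ht) (hq s hs) hij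
        rw [hq0 s hs h₂, hq0 t ht h₁] at hij
        exact (hfr _ hij).elim
    · rintro _ rfl
      exact ⟨mem_range_self _, γ 0, mem_range_self _, by rw [γ0, γ1]⟩
  · rintro _ ⟨i, rfl⟩
    rcases hγ i with ⟨s, -, hi⟩ | ⟨s, -, hi⟩
    · exact .inl ⟨_, hi⟩
    · exact .inr ⟨_, mem_range_self _, hi⟩

end CriticalDisk

/-- Any two nonzero complex numbers can be rotated into the slit plane simultaneously. -/
theorem exists_mul_mem_slitPlane {a b : ℂ} (ha : a ≠ 0) (hb : b ≠ 0) :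
    ∃ c : ℂ, ‖c‖ = 1 ∧ c * a ∈ Complex.slitPlane ∧ c * b ∈ Complex.slitPlane := by
  have key : (a ∈ Complex.slitPlane ∧ b ∈ Complex.slitPlane) ∨
      (-a ∈ Complex.slitPlane ∧ -b ∈ Complex.slitPlane) ∨
      (Complex.I * a ∈ Complex.slitPlane ∧ Complex.I * b ∈ Complex.slitPlane) := by
    simp only [ne_eq, Complex.ext_iff, Complex.zero_re, Complex.zero_im] at ha hb
    simp only [Complex.mem_slitPlane_iff, Complex.neg_re, Complex.neg_im, Complex.mul_re,
      Complex.mul_im, Complex.I_re, Complex.I_im]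
    grind
  rcases key with h | h | h
  · exact ⟨1, by simpa using h⟩
  · exact ⟨-1, by simpa using h⟩
  · exact ⟨Complex.I, by simpa using h⟩

/-- A chart of the complement of a closed disk containing two given points. -/
theorem exists_chart_compl_closedBall {R : ℝ} (hR : 0 ≤ R) {a b : ℂ} (ha : R < ‖a‖)
    (hb : R < ‖b‖) :
    ∃ φ : ℝ × ℝ → ℂ, Continuous φ ∧ IsOpenMap φ ∧ Function.Injective φ ∧
      (∀ p, R < ‖φ p‖) ∧ a ∈ range φ ∧ b ∈ range φ := by
  obtain ⟨c, hc, hca, hcb⟩ := exists_mul_mem_slitPlane (norm_pos_iff.1 (hR.trans_lt ha))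
    (norm_pos_iff.1 (hR.trans_lt hb))
  have hc0 : c ≠ 0 := norm_ne_zero_iff.1 (by rw [hc]; exact one_ne_zero)
  let ψ : ℝ × ℝ → ℝ × ℝ := Prod.map (fun s => R + Real.exp s) fun t => 2 * Real.arctan t
  have hψ : Continuous ψ := by
    have := Real.continuous_arctan
    fun_prop
  have hψo : IsOpenMap ψ := by
    refine IsOpenMap.prodMap ?_ ?_
    · exact isOpenMap_of_hasStrictDerivAt
        (fun s => (Real.hasStrictDerivAt_exp s).const_add R) fun s => (Real.exp_pos s).ne'
    · exact isOpenMap_of_hasStrictDerivAt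
        (fun t => (Real.hasStrictDerivAt_arctan t).const_mul 2) fun t => by positivity
  have hψi : Function.Injective ψ :=
    Function.Injective.prodMap (fun s t h => Real.exp_injective (add_left_cancel h))
      fun s t h => Real.arctan_injective (mul_left_cancel₀ two_ne_zero h)
  have hψt (p : ℝ × ℝ) : ψ p ∈ Complex.polarCoord.target := by
    refine ⟨add_pos_of_nonneg_of_pos hR (Real.exp_pos _), ?_, ?_⟩
    · change -Real.pi < 2 * Real.arctan p.2
      linarith [Real.neg_pi_div_two_lt_arctan p.2]
    · change 2 * Real.arctan p.2 < Real.pi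
      linarith [Real.arctan_lt_pi_div_two p.2]
  have hrange (z : ℂ) (hz : R < ‖z‖) (hcz : c * z ∈ Complex.slitPlane) :
      z ∈ range fun p => c⁻¹ * Complex.polarCoord.symm (ψ p) := by
    refine ⟨(Real.log (‖z‖ - R), Real.tan ((c * z).arg / 2)), ?_⟩
    have hψz : ψ (Real.log (‖z‖ - R), Real.tan ((c * z).arg / 2)) =
        Complex.polarCoord (c * z) := by
      have h₁ := Complex.neg_pi_lt_arg (c * z)
      have h₂ := lt_of_le_of_ne (Complex.arg_le_pi (c * z))
        (Complex.mem_slitPlane_iff_arg.1 hcz).1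
      rw [Complex.polarCoord_apply]
      simp only [ψ, Prod.map_apply]
      rw [Real.exp_log (sub_pos.2 hz), Real.arctan_tan (by linarith) (by linarith), norm_mul, hc]
      simp [mul_div_cancel₀]
    simp only [hψz]
    rw [Complex.polarCoord.left_inv hcz, inv_mul_cancel_left₀ hc0]
  refine ⟨fun p => c⁻¹ * Complex.polarCoord.symm (ψ p), ?_, ?_, ?_, fun p => ?_,
    hrange a ha hca, hrange b hb hcb⟩
  · exact continuous_const.mul
      (Complex.polarCoord.symm.continuousOn.comp_continuous hψ hψt)
  · intro s hs
    have h₁ : IsOpen (Complex.polarCoord.symm '' (ψ '' s)) :=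
      Complex.polarCoord.symm.isOpen_image_of_subset_source (hψo s hs)
        (image_subset_iff.2 fun p _ => hψt p)
    have h₂ := (Homeomorph.mulLeft₀ c⁻¹ (inv_ne_zero hc0)).isOpenMap _ h₁
    rwa [image_image, image_image] at h₂
  · intro s t h
    exact hψi (Complex.polarCoord.symm.injOn (hψt s) (hψt t)
      (mul_left_cancel₀ (inv_ne_zero hc0) h))
  · rw [norm_mul, norm_inv, hc, inv_one, one_mul, Complex.norm_polarCoord_symm]
    exact lt_of_lt_of_le (lt_add_of_pos_right R (Real.exp_pos p.1)) (le_abs_self _)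

/-- For a Brouwer homeomorphism `f` and a compact set `K`, there is a compact set `C`
containing `K ∪ f⁻¹(K)` such that every point outside `C ∪ f⁻¹(C)` admits a translation arc
disjoint from `K`. -/
theorem stmt_14 (f : ℂ ≃ₜ ℂ) (hor : OrientationPreserving f)
    (hfree : ∀ x : ℂ, f x ≠ x) :
    ∀ K : Set ℂ, IsCompact K → ∃ C : Set ℂ, IsCompact C ∧ K ∪ ⇑f ⁻¹' K ⊆ C ∧
      ∀ x ∉ C ∪ ⇑f ⁻¹' C, ∃ γ : C(unitInterval, ℂ),
        TranslationArc f x γ ∧ Set.range γ ∩ K = ∅ := by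
  intro K hK
  obtain ⟨R, hR, hKR⟩ := (hK.union (f.isCompact_preimage.2 hK)).isBounded.subset_closedBall_lt 0 0
  refine ⟨Metric.closedBall 0 R, isCompact_closedBall 0 R, hKR, fun x hx => ?_⟩
  simp only [mem_union, mem_preimage, mem_closedBall_zero_iff, not_or, not_le] at hx
  obtain ⟨φ, hφ, hopen, hinj, hφR, ⟨a, rfl⟩, ⟨b, hb⟩⟩ :=
    exists_chart_compl_closedBall hR.le hx.1 hx.2
  obtain ⟨γ, hγ, hγr⟩ := hor.exists_translationArc_of_chart hfree hφ hopen hinj hb.symm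
  refine ⟨γ, hγ, eq_empty_of_forall_notMem fun v ⟨hv, hvK⟩ => ?_⟩
  rcases hγr hv with ⟨p, rfl⟩ | ⟨_, ⟨p, rfl⟩, rfl⟩
  · exact (hφR p).not_ge (mem_closedBall_zero_iff.1 (hKR (.inl hvK)))
  · exact (hφR p).not_ge (mem_closedBall_zero_iff.1 (hKR (.inr hvK)))
end

section
/- Let X be a smooth complete non-vanishing vector field on ℝ² generating a flow (Φ^t). Let γ : (−ε, ε) → ℝ² be a smooth curve transverse to X (γ'(t) never colinear to X(γ(t))). Then no integral curve of the flow meets γ twice: for every x ∈ ℝ² and s < t with Φ^s(x), Φ^t(x) ∈ γ((−ε,ε)), one has Φ^s(x) = Φ^t(x) only if s = t. Consequently the map Ψ(x, y) = Φ^x(γ(y)) is injective. -/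
namespace PlanarFlow

open Set Filter Topology Complex

theorem eq_of_exp_eqOn_const {A : Type*} [TopologicalSpace A] {S : Set A} (hS : IsPreconnected S)
    {f : A → ℂ} (hf : ContinuousOn f S) {c : ℂ} (hc : ∀ x ∈ S, exp (f x) = c)
    {x y : A} (hx : x ∈ S) (hy : y ∈ S) : f x = f y := by
  refine isCoveringMap_exp.eqOn_of_comp_eqOn hS hf (continuousOn_const (c := f y))
    (fun z hz => Subtype.ext ?_) hy rfl hx
  simp [hc z hz, hc y hy]

theorem _root_.Convex.isSimplyConnected {E : Type*} [AddCommGroup E] [Module ℝ E]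
    [TopologicalSpace E] [ContinuousAdd E] [ContinuousSMul ℝ E] {S : Set E}
    (hS : Convex ℝ S) (hne : S.Nonempty) :
    IsSimplyConnected S := by
  have := hS.contractibleSpace hne
  exact inferInstanceAs (SimplyConnectedSpace S)

theorem exists_continuous_log {X : ℂ → ℂ} (hX : Continuous X) (hX0 : ∀ p, X p ≠ 0) :
    ∃ L : ℂ → ℂ, Continuous L ∧ ∀ p, exp (L p) = X p := by
  obtain ⟨L, hL, hLX⟩ := exists_continuousOn_eqOn_exp_comp
    (convex_univ.isSimplyConnected univ_nonempty) isOpen_univ hX.continuousOn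
    (by simpa using hX0)
  exact ⟨L, continuousOn_univ.1 hL, fun p => hLX (mem_univ p)⟩

/-- A form of Hopf's Umlaufsatz: along a simple closed curve `g`, short secants cannot all avoid
the direction opposite to that of `exp ∘ ℓ` when `ℓ` is itself periodic. -/
theorem false_of_secant_mem_slitPlane {g ℓ : ℝ → ℂ} {P η : ℝ} (hg : Continuous g)
    (hℓ : Continuous ℓ) (hgP : Function.Periodic g P) (hℓP : Function.Periodic ℓ P)
    (hinj : ∀ s t, s < t → t < s + P → g s ≠ g t) (hη : 0 < η) (hηP : η < P)
    (hsec : ∀ s ∈ Icc 0 P, (g (s + η) - g s) * exp (-ℓ s) ∈ slitPlane) : False := by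
  set S : Set (ℝ × ℝ) := {p | p.1 < p.2 ∧ p.2 < p.1 + P} with hSdef
  have hSo : IsOpen S := (isOpen_lt continuous_fst continuous_snd).inter
    (isOpen_lt continuous_snd (continuous_fst.add continuous_const))
  have hSc : Convex ℝ S := by
    intro p hp q hq a b ha hb hab
    obtain rfl : b = 1 - a := by linarith
    simp only [hSdef, mem_ofPred_eq, Prod.fst_add, Prod.snd_add, Prod.smul_fst, Prod.smul_snd,
      smul_eq_mul] at *
    rcases ha.eq_or_lt with rfl | ha
    · constructor <;> nlinarith
    · constructor <;> nlinarith
  have hSS := hSc.isSimplyConnected ⟨(0, η), by simp [hSdef, hη, hηP]⟩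
  set G : ℝ × ℝ → ℂ := fun p => (g p.2 - g p.1) * exp (-ℓ p.1) with hG
  have hGc : Continuous G := by fun_prop
  obtain ⟨H, hH, hHG⟩ := exists_continuousOn_eqOn_exp_comp hSS hSo hGc.continuousOn (by
    rintro ⟨p, hp, h⟩
    simp only [hG, mul_eq_zero, exp_ne_zero, or_false, sub_eq_zero] at h
    exact hinj p.1 p.2 hp.1 hp.2 h.symm)
  replace hHG : ∀ p ∈ S, exp (H p) = G p := hHG
  have hσ : ∀ p ∈ S, (p.2, p.1 + P) ∈ S := fun p hp => ⟨hp.2, by simpa using hp.1⟩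
  set D : ℝ × ℝ → ℂ := fun p => H p - H (p.2, p.1 + P) - ℓ p.2 + ℓ p.1 with hD
  have hDc : ContinuousOn D S := by
    have : ContinuousOn (fun p : ℝ × ℝ => H (p.2, p.1 + P)) S :=
      hH.comp (f := fun p : ℝ × ℝ => (p.2, p.1 + P)) (by fun_prop) hσ
    exact ((hH.sub this).sub (by fun_prop)).add (by fun_prop)
  have hDe : ∀ p ∈ S, exp (D p) = -1 := by
    intro p hp
    have h0 : G (p.2, p.1 + P) ≠ 0 := hHG _ (hσ p hp) ▸ exp_ne_zero _
    rw [hD, exp_add, exp_sub, exp_sub, hHG p hp, hHG _ (hσ p hp)]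
    simp only [hG, hgP p.1, exp_neg] at h0 ⊢
    have h1 : g p.1 - g p.2 ≠ 0 := fun h => h0 (by simp [h])
    have e1 := exp_ne_zero (ℓ p.1)
    have e2 := exp_ne_zero (ℓ p.2)
    field_simp
    ring
  have hDD : ∀ {p q}, p ∈ S → q ∈ S → D p = D q := fun hp hq =>
    eq_of_exp_eqOn_const hSc.isPreconnected hDc hDe hp hq
  have hmem : ∀ s, (s, s + η) ∈ S := fun s => ⟨by simpa, by simpa⟩
  have hdiag := eq_of_exp_eqOn_const (S := Icc 0 P) (c := 1)
    (f := fun s => H (s, s + η) - log ((g (s + η) - g s) * exp (-ℓ s))) isPreconnected_Icc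
    (by
      refine ContinuousOn.sub (hH.comp (by fun_prop) fun s _ => hmem s) ?_
      exact ContinuousOn.clog (by fun_prop) hsec)
    (by
      intro s hs
      rw [exp_sub, hHG _ (hmem s), exp_log (slitPlane_ne_zero (hsec s hs))]
      exact div_self (slitPlane_ne_zero (hsec s hs)))
    (x := 0) (y := P) ⟨le_rfl, by linarith⟩ ⟨by linarith, le_rfl⟩
  have e1 : g (P + η) = g (0 + η) := by rw [add_comm P, zero_add]; exact hgP η
  have e2 : g P = g 0 := by simpa using hgP 0
  have e3 : ℓ P = ℓ 0 := by simpa using hℓP 0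
  simp only [e1, e2, e3, sub_left_inj] at hdiag
  have h1 := hDD (hmem 0) (hσ _ (hmem 0))
  have h2 : D (0, 0 + η) + D (0 + η, 0 + P) = 0 := by
    have : ℓ (0 + P) = ℓ 0 := by simpa using e3
    simp only [zero_add] at hdiag this
    simp only [hD, e3, hdiag, zero_add, add_comm η P]
    ring
  have h3 : D (0, 0 + η) = 0 := by
    rw [← h1] at h2
    linear_combination h2 / 2
  have := hDe _ (hmem 0)
  rw [h3, exp_zero] at this
  norm_num at this

/-- `g` moves locally around the parameter `s` in the direction of positive values of
`z ↦ re (ω * z)`. -/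
def AdvancesAt (g : ℝ → ℂ) (ω : ℂ) (s : ℝ) : Prop :=
  ∀ᶠ p in 𝓝 (s, s), p.1 < p.2 → 0 < (ω * (g p.2 - g p.1)).re

theorem _root_.HasStrictDerivAt.advancesAt {g : ℝ → ℂ} {ω v : ℂ} {s : ℝ}
    (hg : HasStrictDerivAt g v s) (hv : 0 < (ω * v).re) : AdvancesAt g ω s := by
  have h1 : HasStrictDerivAt (fun t => (ω * g t).re) (ω * v).re s :=
    reCLM.hasStrictFDerivAt.comp_hasStrictDerivAt s (hg.const_mul ω)
  have h2 := h1.hasStrictFDerivAt.isLittleO.def (half_pos hv)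
  filter_upwards [h2] with p hp hlt
  have h3 : 0 < p.2 - p.1 := sub_pos.2 hlt
  simp only [ContinuousLinearMap.toSpanSingleton_apply, smul_eq_mul, Real.norm_eq_abs,
    abs_sub_comm p.1 p.2, abs_of_pos h3] at hp
  have h4 := (abs_le.1 hp).2
  rw [mul_sub, sub_re]
  nlinarith

theorem AdvancesAt.glue {g l r : ℝ → ℂ} {ω : ℂ} {s : ℝ} (hl : AdvancesAt l ω s)
    (hr : AdvancesAt r ω s) (hgl : g =ᶠ[𝓝[≤] s] l) (hgr : g =ᶠ[𝓝[≥] s] r) :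
    AdvancesAt g ω s := by
  have hl' := eventually_nhdsWithin_iff.1 hgl
  have hr' := eventually_nhdsWithin_iff.1 hgr
  have el := hl'.self_of_nhds self_mem_Iic
  have er := hr'.self_of_nhds self_mem_Ici
  have t1 : Tendsto (fun p : ℝ × ℝ => p.1) (𝓝 (s, s)) (𝓝 s) := continuous_fst.tendsto (s, s)
  have t2 : Tendsto (fun p : ℝ × ℝ => p.2) (𝓝 (s, s)) (𝓝 s) := continuous_snd.tendsto (s, s)
  have hls : ∀ᶠ p : ℝ × ℝ in 𝓝 (s, s), p.1 < s → 0 < (ω * (l s - l p.1)).re :=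
    (t1.prodMk_nhds (tendsto_const_nhds (x := s))).eventually hl
  have hrs : ∀ᶠ p : ℝ × ℝ in 𝓝 (s, s), s < p.2 → 0 < (ω * (r p.2 - r s)).re :=
    ((tendsto_const_nhds (x := s)).prodMk_nhds t2).eventually hr
  filter_upwards [hl, hr, hls, hrs, t1.eventually hl', t2.eventually hl', t1.eventually hr',
    t2.eventually hr'] with p a1 a2 a3 a4 b1 b2 b3 b4 hlt
  rcases le_total p.2 s with h | h
  · rw [b2 h, b1 (hlt.le.trans h)]
    exact a1 hlt
  rcases le_total s p.1 with h' | h'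
  · rw [b4 h, b3 h']
    exact a2 hlt
  rw [b4 h, b1 h']
  rcases h.eq_or_lt with h | h
  · rw [← h, ← er, el]
    exact a3 (h ▸ hlt)
  rcases h'.eq_or_lt with h' | h'
  · rw [h', ← el, er]
    exact a4 h
  have := add_pos (a3 h') (a4 h)
  rwa [← add_re, ← mul_add, ← el, ← er, sub_add_sub_cancel'] at this

theorem conj_mul_self_re_pos {z : ℂ} (hz : z ≠ 0) : 0 < ((starRingEnd ℂ) z * z).re := by
  rw [← normSq_eq_conj_mul_self, ofReal_re]
  exact normSq_pos.2 hz

theorem mul_inv_mem_slitPlane {ω z w : ℂ} (hz : 0 < (ω * z).re) (hw : 0 < (ω * w).re) :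
    z * w⁻¹ ∈ slitPlane := by
  have hw0 : w ≠ 0 := by rintro rfl; simp at hw
  by_contra h
  simp only [mem_slitPlane_iff, not_or, not_lt, not_not] at h
  have h2 : ω * z = ((z * w⁻¹).re : ℂ) * (ω * w) := by
    have : z * w⁻¹ = ((z * w⁻¹).re : ℂ) := Complex.ext (by simp) (by simpa using h.2)
    rw [← this]
    field_simp
  rw [h2, re_ofReal_mul] at hz
  nlinarith [h.1]

theorem false_of_advancesAt {X : ℂ → ℂ} (hX : Continuous X) (hX0 : ∀ p, X p ≠ 0)
    {g : ℝ → ℂ} {P : ℝ} (hP : 0 < P) (hg : Continuous g) (hgP : Function.Periodic g P)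
    (hinj : ∀ s t, s < t → t < s + P → g s ≠ g t)
    (hadv : ∀ s, ∃ ω, 0 < (ω * X (g s)).re ∧ AdvancesAt g ω s) : False := by
  obtain ⟨L, hL, hLX⟩ := exists_continuous_log hX hX0
  have hloc : ∀ s ∈ Icc 0 P, ∀ᶠ z : ℝ × ℝ in 𝓝 (0, s), 0 < z.1 →
      (g (z.2 + z.1) - g z.2) * exp (-L (g z.2)) ∈ slitPlane := by
    intro s _
    obtain ⟨ω, hω, hs⟩ := hadv s
    have h1 : Tendsto (fun z : ℝ × ℝ => (z.2, z.2 + z.1)) (𝓝 (0, s)) (𝓝 (s, s)) := by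
      have : Continuous (fun z : ℝ × ℝ => (z.2, z.2 + z.1)) := by fun_prop
      simpa using this.tendsto (0, s)
    have h2 : ∀ᶠ z : ℝ × ℝ in 𝓝 (0, s), 0 < (ω * X (g z.2)).re :=
      (show Continuous fun z : ℝ × ℝ => (ω * X (g z.2)).re by fun_prop).continuousAt.eventually
        (lt_mem_nhds hω)
    filter_upwards [h1.eventually hs, h2] with z hz1 hz2 hpos
    rw [exp_neg, hLX]
    exact mul_inv_mem_slitPlane (hz1 (by simpa using hpos)) hz2
  have hunif := isCompact_Icc.eventually_forall_of_forall_eventually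
    (P := fun η s => 0 < η → (g (s + η) - g s) * exp (-L (g s)) ∈ slitPlane) hloc
  obtain ⟨η, hη, hη0, hηP⟩ := ((hunif.filter_mono nhdsWithin_le_nhds).and
    (Ioo_mem_nhdsGT hP)).exists
  exact false_of_secant_mem_slitPlane (ℓ := L ∘ g) hg (hL.comp hg) hgP (hgP.comp L) hinj hη0 hηP
    fun s hs => hη s hs hη0

/-- The curve with period `2` running alternately through the arcs `a` and `b`. -/
noncomputable def alternate (a b : ℝ → ℂ) (t : ℝ) : ℂ :=
  if Even ⌊t⌋ then a (Int.fract t) else b (Int.fract t)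

variable {a b : ℝ → ℂ}

theorem alternate_eq_on_Icc (hab : a 1 = b 0) (hba : b 1 = a 0) (n : ℤ) {t : ℝ}
    (ht : t ∈ Icc (n : ℝ) (n + 1)) :
    alternate a b t = if Even n then a (t - n) else b (t - n) := by
  rcases ht.2.eq_or_lt with h | h
  · have h1 : t = ((n + 1 : ℤ) : ℝ) := by push_cast; exact h
    by_cases hn : Even n <;> simp [alternate, h1, hn, hab, hba]
  · have h1 : ⌊t⌋ = n := Int.floor_eq_iff.2 ⟨ht.1, h⟩
    simp only [alternate, Int.fract, h1]

theorem alternate_eventuallyEq_right (hab : a 1 = b 0) (hba : b 1 = a 0) (s : ℝ) :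
    alternate a b =ᶠ[𝓝[≥] s] fun t => if Even ⌊s⌋ then a (t - ⌊s⌋) else b (t - ⌊s⌋) := by
  filter_upwards [Ico_mem_nhdsGE (Int.lt_floor_add_one s)] with t ht
  exact alternate_eq_on_Icc hab hba _ ⟨(Int.floor_le s).trans ht.1, ht.2.le⟩

theorem alternate_eventuallyEq_left (hab : a 1 = b 0) (hba : b 1 = a 0) (s : ℝ) :
    alternate a b =ᶠ[𝓝[≤] s]
      fun t => if Even (⌈s⌉ - 1) then a (t - (⌈s⌉ - 1 : ℤ)) else b (t - (⌈s⌉ - 1 : ℤ)) := by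
  have h1 : ((⌈s⌉ - 1 : ℤ) : ℝ) < s := by
    have := Int.ceil_lt_add_one s
    push_cast; linarith
  filter_upwards [Ioc_mem_nhdsLE h1] with t ht
  refine alternate_eq_on_Icc hab hba _ ⟨ht.1.le, ht.2.trans ?_⟩
  push_cast
  linarith [Int.le_ceil s]

theorem alternate_periodic : Function.Periodic (alternate a b) 2 := by
  intro t
  have h1 : ⌊t + 2⌋ = ⌊t⌋ + 2 := by exact_mod_cast Int.floor_add_intCast t 2
  have h2 : Int.fract (t + 2) = Int.fract t := by exact_mod_cast Int.fract_add_intCast t 2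
  simp only [alternate, h1, h2, Int.even_add, even_two, iff_true]

theorem alternate_ne (ha : InjOn a (Ico 0 1)) (hb : InjOn b (Ico 0 1))
    (hdisj : ∀ u ∈ Ico (0 : ℝ) 1, ∀ v ∈ Ico (0 : ℝ) 1, a u ≠ b v) {s t : ℝ} (hst : s < t)
    (hts : t < s + 2) : alternate a b s ≠ alternate a b t := by
  have fs : Int.fract s ∈ Ico (0 : ℝ) 1 := ⟨Int.fract_nonneg s, Int.fract_lt_one s⟩
  have ft : Int.fract t ∈ Ico (0 : ℝ) 1 := ⟨Int.fract_nonneg t, Int.fract_lt_one t⟩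
  have key : Int.fract s = Int.fract t → (Even ⌊s⌋ ↔ Even ⌊t⌋) → False := by
    intro h hp
    have e1 := Int.floor_add_fract s
    have e2 := Int.floor_add_fract t
    have l1 : (⌊s⌋ : ℝ) < ⌊t⌋ := by linarith
    have l2 : (⌊t⌋ : ℝ) < ⌊s⌋ + 2 := by linarith
    have l1' : ⌊s⌋ < ⌊t⌋ := by exact_mod_cast l1
    have l2' : ⌊t⌋ < ⌊s⌋ + 2 := by exact_mod_cast l2
    have l3 : ⌊t⌋ = ⌊s⌋ + 1 := by omega
    rw [l3, Int.even_add_one] at hp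
    tauto
  intro h
  by_cases h1 : Even ⌊s⌋ <;> by_cases h2 : Even ⌊t⌋ <;> simp only [alternate, h1, h2] at h
  · exact key (ha fs ft h) (by simp [h1, h2])
  · exact hdisj _ fs _ ft h
  · exact hdisj _ ft _ fs h.symm
  · exact key (hb fs ft h) (by simp [h1, h2])

/-- An orbit arc `a` of a nowhere vanishing planar vector field and a `C¹` arc `b` that is nowhere
tangent to the opposite direction do not form a simple closed curve. -/
theorem not_closed_of_orbit_arc_of_transverse_arc {X : ℂ → ℂ} (hX : Continuous X)
    (hX0 : ∀ p, X p ≠ 0) {T : ℝ} (hT : 0 < T)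
    (ha : ∀ u ∈ Icc (0 : ℝ) 1, HasStrictDerivAt a (T * X (a u)) u)
    (hb : ∀ u ∈ Icc (0 : ℝ) 1, ∃ ω v, HasStrictDerivAt b v u ∧ 0 < (ω * X (b u)).re ∧
      0 < (ω * v).re)
    (hab : a 1 = b 0) (hba : b 1 = a 0) (hainj : InjOn a (Ico 0 1)) (hbinj : InjOn b (Ico 0 1))
    (hdisj : ∀ u ∈ Ico (0 : ℝ) 1, ∀ v ∈ Ico (0 : ℝ) 1, a u ≠ b v) : False := by
  have hsub : ∀ (φ : ℝ → ℂ) (v : ℂ) (s c : ℝ), HasStrictDerivAt φ v (s - c) →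
      HasStrictDerivAt (fun t => φ (t - c)) v s := fun φ v s c h => by
    simpa [Function.comp_def] using h.scomp s ((hasStrictDerivAt_id s).sub_const c)
  have har : ∀ ω u, 0 < (ω * X (a u)).re → 0 < (ω * (T * X (a u))).re := by
    intro ω u h
    rw [mul_left_comm, re_ofReal_mul]
    exact mul_pos hT h
  have haω : ∀ u ∈ Icc (0 : ℝ) 1, ∃ ω v, HasStrictDerivAt a v u ∧ 0 < (ω * X (a u)).re ∧
      0 < (ω * v).re := by
    intro u hu
    have h1 := conj_mul_self_re_pos (hX0 (a u))
    exact ⟨_, _, ha u hu, h1, har _ u h1⟩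
  have hloc : ∀ s : ℝ, ∃ ω l r vl vr, 0 < (ω * X (alternate a b s)).re ∧
      alternate a b =ᶠ[𝓝[≤] s] l ∧ alternate a b =ᶠ[𝓝[≥] s] r ∧
      HasStrictDerivAt l vl s ∧ HasStrictDerivAt r vr s ∧
      0 < (ω * vl).re ∧ 0 < (ω * vr).re := by
    intro s
    have er := alternate_eventuallyEq_right hab hba s
    have el := alternate_eventuallyEq_left hab hba s
    have er0 := er.self_of_nhdsWithin self_mem_Ici
    have el0 := el.self_of_nhdsWithin self_mem_Iic
    set n := ⌊s⌋ with hn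
    set m := ⌈s⌉ - 1 with hm
    have mn : s - n ∈ Icc (0 : ℝ) 1 :=
      ⟨by linarith [Int.floor_le s], by linarith [Int.lt_floor_add_one s]⟩
    have mm : s - m ∈ Icc (0 : ℝ) 1 := by
      have h1 := Int.le_ceil s
      have h2 := Int.ceil_lt_add_one s
      constructor <;> (rw [hm]; push_cast; linarith)
    have hnm : n = m ∨ n = m + 1 := by
      have h1 : (n : ℝ) < m + 2 := by linarith [mn.1, mm.2]
      have h2 : (m : ℝ) < n + 1 := by
        have h1 := Int.ceil_lt_add_one s
        have h2 := Int.lt_floor_add_one s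
        rw [hm]; push_cast; linarith
      have h1' : n < m + 2 := by exact_mod_cast h1
      have h2' : m < n + 1 := by exact_mod_cast h2
      omega
    by_cases hne : Even n <;> by_cases hme : Even m <;> simp only [hne, hme, if_true,
      if_false] at er el er0 el0
    · obtain ⟨ω, v, h1, h2, h3⟩ := haω _ mn
      rw [← er0, el0] at h2
      exact ⟨ω, _, _, _, _, by rwa [el0], el, er, hsub _ _ _ _ (ha _ mm), hsub _ _ _ _ h1,
        har _ _ h2, h3⟩
    · obtain ⟨ω, v, h1, h2, h3⟩ := hb _ mm
      rw [← el0] at h2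
      exact ⟨ω, _, _, _, _, h2, el, er, hsub _ _ _ _ h1, hsub _ _ _ _ (ha _ mn), h3,
        har _ _ (er0 ▸ h2)⟩
    · obtain ⟨ω, v, h1, h2, h3⟩ := hb _ mn
      rw [← er0] at h2
      exact ⟨ω, _, _, _, _, h2, el, er, hsub _ _ _ _ (ha _ mm), hsub _ _ _ _ h1,
        har _ _ (el0 ▸ h2), h3⟩
    · have hnm : n = m := by
        rcases hnm with h | h
        · exact h
        · rw [h, Int.even_add_one] at hne
          exact absurd hme hne
      rw [← hnm] at el
      obtain ⟨ω, v, h1, h2, h3⟩ := hb _ mn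
      rw [← er0] at h2
      exact ⟨ω, _, _, _, _, h2, el, er, hsub _ _ _ _ h1, hsub _ _ _ _ h1, h3, h3⟩
  refine false_of_advancesAt hX hX0 two_pos ?_ (alternate_periodic (a := a) (b := b))
    (fun s t => alternate_ne hainj hbinj hdisj) ?_
  · refine continuous_iff_continuousAt.2 fun s => continuousAt_iff_continuous_left_right.2 ?_
    obtain ⟨ω, l, r, vl, vr, -, el, er, dl, dr, -⟩ := hloc s
    exact ⟨dl.hasDerivAt.continuousAt.continuousWithinAt.congr_of_eventuallyEq el
        (el.self_of_nhdsWithin self_mem_Iic),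
      dr.hasDerivAt.continuousAt.continuousWithinAt.congr_of_eventuallyEq er
        (er.self_of_nhdsWithin self_mem_Ici)⟩
  · intro s
    obtain ⟨ω, l, r, vl, vr, hω, el, er, dl, dr, hl, hr⟩ := hloc s
    exact ⟨ω, hω, (dl.advancesAt hl).glue (dr.advancesAt hr) el er⟩

theorem _root_.LinearIndependent.exists_mul_re_pos {v w : ℂ}
    (h : LinearIndependent ℝ ![v, w]) : ∃ ω : ℂ, 0 < (ω * v).re ∧ 0 < (ω * w).re := by
  set d : ℝ := w.im * v.re - w.re * v.im with hd
  have hd0 : d ≠ 0 := by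
    intro h0
    rw [LinearIndependent.pair_iff] at h
    have h1 := h w.im (-v.im) (Complex.ext (by simp; linarith) (by simp; ring))
    have h2 := h w.re (-v.re) (Complex.ext (by simp; ring) (by simp; linarith))
    have h3 : v = 0 := Complex.ext (by simpa using h2.2) (by simpa using h1.2)
    exact one_ne_zero (h 1 0 (by simp [h3])).1
  have hd2 : 0 < d * d := mul_self_pos.2 hd0
  refine ⟨d * (⟨w.im - v.im, w.re - v.re⟩), ?_, ?_⟩ <;>
  · convert hd2 using 1
    simp only [mul_re, mul_im, ofReal_re, ofReal_im, hd]
    ring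

theorem AdvancesAt.right {g : ℝ → ℂ} {ω : ℂ} {s : ℝ} (h : AdvancesAt g ω s) :
    ∀ᶠ t in 𝓝 s, s < t → 0 < (ω * (g t - g s)).re :=
  ((tendsto_const_nhds (x := s)).prodMk_nhds tendsto_id).eventually h

theorem AdvancesAt.left {g : ℝ → ℂ} {ω : ℂ} {s : ℝ} (h : AdvancesAt g ω s) :
    ∀ᶠ t in 𝓝 s, t < s → 0 < (ω * (g s - g t)).re :=
  (tendsto_id.prodMk_nhds (tendsto_const_nhds (x := s))).eventually h

theorem eventually_notMem_of_transverse {c γ : ℝ → ℂ} {v w : ℂ} {K : Set ℝ} {y : ℝ}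
    (hK : IsCompact K) (hy : y ∈ K) (hγK : ContinuousOn γ K) (hinj : InjOn γ K)
    (hc : HasStrictDerivAt c v 0) (hc0 : c 0 = γ y) (hγ : HasStrictDerivAt γ w y)
    (hvw : LinearIndependent ℝ ![w, v]) :
    ∀ᶠ t in 𝓝[>] 0, c t ∉ γ '' K := by
  obtain ⟨ω₁, hw₁, hv₁⟩ := hvw.exists_mul_re_pos
  have hvw' : LinearIndependent ℝ ![-w, v] := by
    rw [LinearIndependent.pair_iff] at hvw ⊢
    intro s t hst
    have := hvw (-s) t (by simpa using hst)
    simpa using this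
  obtain ⟨ω₂, hw₂, hv₂⟩ := hvw'.exists_mul_re_pos
  have hγ₁ := hγ.advancesAt hw₁
  have hγ₂ : AdvancesAt γ (-ω₂) y := hγ.advancesAt (by simpa using hw₂)
  obtain ⟨U, hU, hUo, hyU⟩ := eventually_nhds_iff.1
    (hγ₁.right.and <| hγ₁.left.and <| hγ₂.right.and hγ₂.left)
  have hfar : ∀ᶠ t in 𝓝 (0 : ℝ), c t ∉ γ '' (K \ U) := by
    have h1 : IsCompact (γ '' (K \ U)) := (hK.diff hUo).image_of_continuousOn (hγK.mono sdiff_subset)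
    refine hc.hasDerivAt.continuousAt.eventually (h1.isClosed.isOpen_compl.mem_nhds ?_)
    rintro ⟨u, hu, hue⟩
    rw [hc0] at hue
    exact hu.2 (hinj hu.1 hy hue ▸ hyU)
  filter_upwards [nhdsWithin_le_nhds hfar, nhdsWithin_le_nhds (hc.advancesAt hv₁).right,
    nhdsWithin_le_nhds (hc.advancesAt hv₂).right, self_mem_nhdsWithin] with t h1 h2 h3 ht
  rintro ⟨u, hu, hue⟩
  by_cases huU : u ∈ U
  · obtain ⟨r1, l1, r2, l2⟩ := hU u huU
    have h2 := h2 ht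
    have h3 := h3 ht
    rw [← hue, hc0] at h2 h3
    rcases lt_trichotomy u y with h | rfl | h
    · have := l1 h
      rw [← neg_sub, mul_neg, neg_re] at this
      linarith
    · simp at h2
    · have := r2 h
      rw [neg_mul, neg_re] at this
      linarith
  · exact h1 ⟨u, ⟨hu, huU⟩, hue⟩

section Flow

variable {X : ℂ → ℂ} {Φ : ℝ → ℂ → ℂ}

theorem hasStrictDerivAt_orbit (hX : Continuous X)
    (hODE : ∀ t x, HasDerivAt (fun τ : ℝ => Φ τ x) (X (Φ t x)) t) (t : ℝ) (x : ℂ) :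
    HasStrictDerivAt (fun τ : ℝ => Φ τ x) (X (Φ t x)) t :=
  hasStrictDerivAt_of_hasDerivAt_of_continuousAt (f' := fun t => X (Φ t x))
    (Eventually.of_forall fun t => hODE t x) (hX.continuousAt.comp (hODE t x).continuousAt)

theorem hasStrictDerivAt_orbit_affine (hX : Continuous X)
    (hODE : ∀ t x, HasDerivAt (fun τ : ℝ => Φ τ x) (X (Φ t x)) t) (T c u : ℝ) (x : ℂ) :
    HasStrictDerivAt (fun u : ℝ => Φ (u * T + c) x) (T * X (Φ (u * T + c) x)) u := by
  have h := (hasStrictDerivAt_orbit hX hODE (u * T + c) x).scomp u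
    (((hasStrictDerivAt_id u).mul_const T).add_const c)
  simpa [Function.comp_def] using h

theorem eq_of_flow_eq (hΦ0 : ∀ x, Φ 0 x = x) (hΦadd : ∀ s t x, Φ (s + t) x = Φ s (Φ t x))
    {s t : ℝ} {x y : ℂ} (h : Φ s x = Φ t y) : x = Φ (t - s) y := by
  have := congrArg (Φ (-s)) h
  rwa [← hΦadd, ← hΦadd, neg_add_cancel, hΦ0, neg_add_eq_sub] at this

theorem isLeast_of_isClosed_of_eventually {c : ℝ → ℂ} (hc : Continuous c) {K : Set ℂ}
    (hK : IsClosed K) (hev : ∀ᶠ t in 𝓝[>] (0 : ℝ), c t ∉ K) (hex : ∃ t > 0, c t ∈ K) :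
    ∃ T, IsLeast {t | 0 < t ∧ c t ∈ K} T := by
  obtain ⟨δ, hδ, hδK⟩ := mem_nhdsGT_iff_exists_Ioo_subset.1 hev
  have hS : {t | 0 < t ∧ c t ∈ K} = Ici δ ∩ c ⁻¹' K := by
    ext t
    refine ⟨fun ⟨h1, h2⟩ => ⟨?_, h2⟩, fun ⟨h1, h2⟩ => ⟨lt_of_lt_of_le hδ h1, h2⟩⟩
    by_contra h
    exact hδK ⟨h1, not_le.1 h⟩ h2
  have hcl : IsClosed {t | 0 < t ∧ c t ∈ K} := hS ▸ isClosed_Ici.inter (hK.preimage hc)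
  have hbd : BddBelow {t | 0 < t ∧ c t ∈ K} := ⟨0, fun t ht => ht.1.le⟩
  exact ⟨_, hcl.csInf_mem hex hbd, fun t ht => csInf_le hbd ht⟩

/-- A nowhere vanishing planar vector field has no periodic orbit. -/
theorem flow_ne_self (hX : Continuous X) (hX0 : ∀ p, X p ≠ 0) (hΦ0 : ∀ x, Φ 0 x = x)
    (hΦadd : ∀ s t x, Φ (s + t) x = Φ s (Φ t x))
    (hODE : ∀ t x, HasDerivAt (fun τ : ℝ => Φ τ x) (X (Φ t x)) t) {t : ℝ} (ht : 0 < t) (x : ℂ) :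
    Φ t x ≠ x := by
  intro htx
  have hpos : ∀ p, 0 < ((starRingEnd ℂ) (X p) * X p).re := fun p => conj_mul_self_re_pos (hX0 p)
  have hcont : Continuous fun t => Φ t x :=
    continuous_iff_continuousAt.2 fun t => (hODE t x).continuousAt
  obtain ⟨T, ⟨hT, hTx⟩, hmin⟩ := isLeast_of_isClosed_of_eventually hcont (K := {x})
    isClosed_singleton (by
      filter_upwards [nhdsWithin_le_nhds ((hasStrictDerivAt_orbit hX hODE 0 x).advancesAt
        (hpos _)).right, self_mem_nhdsWithin] with t h ht hx
      have h := h ht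
      simp only [hΦ0, mem_singleton_iff] at h hx
      simp [hx] at h) ⟨t, ht, htx⟩
  have key : ∀ s t, s < t → t < s + T → Φ s x ≠ Φ t x := by
    intro s t hst hts h
    have h1 := eq_of_flow_eq hΦ0 hΦadd h
    linarith [hmin ⟨sub_pos.2 hst, h1.symm⟩]
  have key' : ∀ c, InjOn (fun u => Φ (u * (T / 2) + c) x) (Ico 0 1) := by
    intro c u hu v hv h
    rcases lt_trichotomy u v with h1 | h1 | h1
    · exact absurd h (key _ _ (by nlinarith) (by nlinarith [hu.1, hv.2]))
    · exact h1
    · exact absurd h.symm (key _ _ (by nlinarith) (by nlinarith [hv.1, hu.2]))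
  refine not_closed_of_orbit_arc_of_transverse_arc hX hX0 (half_pos hT)
    (a := fun u => Φ (u * (T / 2) + 0) x) (b := fun u => Φ (u * (T / 2) + T / 2) x)
    (fun u _ => hasStrictDerivAt_orbit_affine hX hODE _ _ _ _)
    (fun u _ => ⟨_, _, hasStrictDerivAt_orbit_affine hX hODE _ _ _ _, hpos _, ?_⟩)
    (by simp) ?_ (key' _) (key' _) ?_
  · rw [mul_left_comm, re_ofReal_mul]
    exact mul_pos (half_pos hT) (hpos _)
  · have : Φ T x = x := hTx
    simp [this, hΦ0]
  · intro u hu v hv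
    exact key _ _ (by nlinarith [hu.2, hv.1]) (by nlinarith [hu.1, hv.2])

theorem flow_injective (hX : Continuous X) (hX0 : ∀ p, X p ≠ 0) (hΦ0 : ∀ x, Φ 0 x = x)
    (hΦadd : ∀ s t x, Φ (s + t) x = Φ s (Φ t x))
    (hODE : ∀ t x, HasDerivAt (fun τ : ℝ => Φ τ x) (X (Φ t x)) t) (x : ℂ) :
    Function.Injective fun t => Φ t x := by
  intro s t h
  rcases lt_trichotomy s t with h1 | h1 | h1
  · exact absurd (eq_of_flow_eq hΦ0 hΦadd h).symm
      (flow_ne_self hX hX0 hΦ0 hΦadd hODE (sub_pos.2 h1) x)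
  · exact h1
  · exact absurd (eq_of_flow_eq hΦ0 hΦadd h.symm).symm
      (flow_ne_self hX hX0 hΦ0 hΦadd hODE (sub_pos.2 h1) x)

/-- An orbit does not return to an arc transverse to a nowhere vanishing planar vector field. -/
theorem flow_ne_of_transverse (hX : Continuous X) (hX0 : ∀ p, X p ≠ 0) (hΦ0 : ∀ x, Φ 0 x = x)
    (hΦadd : ∀ s t x, Φ (s + t) x = Φ s (Φ t x))
    (hODE : ∀ t x, HasDerivAt (fun τ : ℝ => Φ τ x) (X (Φ t x)) t)
    {I : Set ℝ} (hI : I.OrdConnected) {γ γ' : ℝ → ℂ}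
    (hγ : ∀ y ∈ I, HasStrictDerivAt γ (γ' y) y) (hγinj : InjOn γ I)
    (htrans : ∀ y ∈ I, LinearIndependent ℝ ![γ' y, X (γ y)])
    {y₁ y₂ T : ℝ} (h₁ : y₁ ∈ I) (h₂ : y₂ ∈ I) (hT : 0 < T) : Φ T (γ y₁) ≠ γ y₂ := by
  intro hTy
  set p := γ y₁ with hp
  have hΦinj := flow_injective hX hX0 hΦ0 hΦadd hODE p
  have hcont : Continuous fun t => Φ t p :=
    continuous_iff_continuousAt.2 fun t => (hODE t p).continuousAt
  have hKI : uIcc y₁ y₂ ⊆ I := hI.uIcc_subset h₁ h₂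
  have hγc : ContinuousOn γ (uIcc y₁ y₂) := fun y hy =>
    (hγ y (hKI hy)).hasDerivAt.continuousAt.continuousWithinAt
  have horb := hasStrictDerivAt_orbit hX hODE 0 p
  have hind : LinearIndependent ℝ ![γ' y₁, X (Φ 0 p)] := by
    rw [hΦ0]
    exact htrans y₁ h₁
  obtain ⟨S, ⟨hS, z, hz, hSz⟩, hmin⟩ := isLeast_of_isClosed_of_eventually hcont
    (isCompact_uIcc.image_of_continuousOn hγc).isClosed
    (eventually_notMem_of_transverse isCompact_uIcc left_mem_uIcc hγc (hγinj.mono hKI)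
      horb (hΦ0 p) (hγ _ h₁) hind) ⟨T, hT, y₂, right_mem_uIcc, hTy.symm⟩
  replace hSz : γ z = Φ S p := hSz
  have hzy : y₁ - z ≠ 0 := by
    intro h
    rw [← sub_eq_zero.1 h, ← hp] at hSz
    exact flow_ne_self hX hX0 hΦ0 hΦadd hODE hS p hSz.symm
  have hmem : ∀ v ∈ Icc (0 : ℝ) 1, v * (y₁ - z) + z ∈ uIcc y₁ y₂ := by
    intro v hv
    have := (convex_uIcc y₁ y₂) left_mem_uIcc hz hv.1 (sub_nonneg.2 hv.2) (by ring)
    convert this using 1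
    simp only [smul_eq_mul]
    ring
  have hbinj : InjOn (fun v => γ (v * (y₁ - z) + z)) (Icc 0 1) := by
    intro v hv w hw h
    have := hγinj (hKI (hmem v hv)) (hKI (hmem w hw)) h
    exact mul_right_cancel₀ hzy (add_right_cancel this)
  refine not_closed_of_orbit_arc_of_transverse_arc hX hX0 hS
    (a := fun u => Φ (u * S + 0) p) (b := fun v => γ (v * (y₁ - z) + z))
    (fun u _ => hasStrictDerivAt_orbit_affine hX hODE _ _ _ _) ?_
    (by simp [hSz]) (by simp [hΦ0, hp]) ?_ (hbinj.mono Ico_subset_Icc_self) ?_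
  · intro u hu
    have hmu := hKI (hmem u hu)
    have hd := (hγ _ hmu).scomp u (((hasStrictDerivAt_id u).mul_const (y₁ - z)).add_const z)
    have hli : LinearIndependent ℝ ![(y₁ - z) • γ' (u * (y₁ - z) + z),
        X (γ (u * (y₁ - z) + z))] := by
      have := htrans _ hmu
      rw [LinearIndependent.pair_iff] at this ⊢
      intro s t hst
      have := this (s * (y₁ - z)) t (by rwa [mul_smul])
      exact ⟨(mul_eq_zero.1 this.1).resolve_right hzy, this.2⟩
    obtain ⟨ω, hω1, hω2⟩ := hli.exists_mul_re_pos
    exact ⟨ω, _, by simpa [Function.comp_def] using hd, hω2, by simpa using hω1⟩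
  · intro u _ v _ h
    have := hΦinj h
    simpa [hS.ne'] using this
  · intro u hu v hv h
    rcases hu.1.eq_or_lt with rfl | hu0
    · have h1 : (fun v => γ (v * (y₁ - z) + z)) v = (fun v => γ (v * (y₁ - z) + z)) 1 := by
        simp [← h, hΦ0, hp]
      exact hv.2.ne (hbinj ⟨hv.1, hv.2.le⟩ ⟨zero_le_one, le_rfl⟩ h1)
    · have h1 := hmin (a := u * S) ⟨mul_pos hu0 hS, _, hmem v ⟨hv.1, hv.2.le⟩,
        by simpa using h.symm⟩
      nlinarith [hu.2]

end Flow

end PlanarFlow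

/-- Poincaré–Bendixson basic lemma: no integral curve of a smooth complete non-vanishing
planar vector field meets a transverse curve twice at the same point at different times, and
the map `Ψ(x, y) = Φ^x(γ(y))` is injective. -/
theorem stmt_17 (X : ℂ → ℂ) (hX : ContDiff ℝ (⊤ : ℕ∞) X) (hX0 : ∀ p, X p ≠ 0)
    (Φ : ℝ → ℂ → ℂ)
    (hΦ0 : ∀ x, Φ 0 x = x)
    (hΦadd : ∀ s t x, Φ (s + t) x = Φ s (Φ t x))
    (hODE : ∀ t x, HasDerivAt (fun τ : ℝ => Φ τ x) (X (Φ t x)) t)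
    (ε : ℝ) (hε : 0 < ε) (γ γ' : ℝ → ℂ)
    (hγsm : ContDiffOn ℝ (⊤ : ℕ∞) γ (Set.Ioo (-ε) ε))
    (hγ' : ∀ y ∈ Set.Ioo (-ε) ε, HasDerivAt γ (γ' y) y)
    (hγinj : Set.InjOn γ (Set.Ioo (-ε) ε))
    (htrans : ∀ y ∈ Set.Ioo (-ε) ε, LinearIndependent ℝ ![γ' y, X (γ y)]) :
    (∀ (x : ℂ) (s t : ℝ), Φ s x ∈ γ '' Set.Ioo (-ε) ε → Φ t x ∈ γ '' Set.Ioo (-ε) ε →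
      Φ s x = Φ t x → s = t) ∧
    Set.InjOn (fun p : ℝ × ℝ => Φ p.1 (γ p.2)) (Set.univ ×ˢ Set.Ioo (-ε) ε) := by
  have hinj := PlanarFlow.flow_injective hX.continuous hX0 hΦ0 hΦadd hODE
  refine ⟨fun x s t _ _ h => hinj x h, ?_⟩
  rintro ⟨s, y⟩ ⟨-, hy⟩ ⟨t, z⟩ ⟨-, hz⟩ h
  have hγstrict : ∀ y ∈ Set.Ioo (-ε) ε, HasStrictDerivAt γ (γ' y) y := fun y hy =>
    (hγsm.contDiffAt (isOpen_Ioo.mem_nhds hy)).hasStrictDerivAt' (hγ' y hy) (by simp)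
  have hne := fun {y z T : ℝ} => PlanarFlow.flow_ne_of_transverse (y₁ := y) (y₂ := z) (T := T)
    hX.continuous hX0 hΦ0 hΦadd hODE Set.ordConnected_Ioo hγstrict hγinj htrans
  rcases lt_trichotomy s t with h1 | rfl | h1
  · exact absurd (PlanarFlow.eq_of_flow_eq hΦ0 hΦadd h).symm (hne hz hy (sub_pos.2 h1))
  · have h2 := PlanarFlow.eq_of_flow_eq hΦ0 hΦadd h
    rw [sub_self, hΦ0] at h2
    exact Prod.ext rfl (hγinj hy hz h2)
  · exact absurd (PlanarFlow.eq_of_flow_eq hΦ0 hΦadd h.symm).symm (hne hy hz (sub_pos.2 h1))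
end

section
/- Let X be a smooth complete non-vanishing vector field on the plane with flow (Φ^t). Then every integral curve is proper: for every x ∈ ℝ² and every compact K ⊆ ℝ², the set {t ∈ ℝ : Φ^t(x) ∈ K} is compact. -/
open Set Filter Topology

/-- Two continuous logarithms of the same function on a preconnected set that agree at a point
agree everywhere. -/
theorem eqOn_of_exp_eqOn {α : Type*} [TopologicalSpace α] {S : Set α} (hS : IsPreconnected S)
    {f g : α → ℂ} (hf : ContinuousOn f S) (hg : ContinuousOn g S)
    (hfg : ∀ x ∈ S, Complex.exp (f x) = Complex.exp (g x)) {x₀ : α} (hx₀ : x₀ ∈ S)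
    (h₀ : f x₀ = g x₀) : EqOn f g S := by
  have key : ∀ x ∈ S, ∃ n : ℤ, f x - g x = n * (2 * Real.pi * Complex.I) := fun x hx => by
    obtain ⟨n, hn⟩ := Complex.exp_eq_exp_iff_exists_int.1 (hfg x hx)
    exact ⟨n, by rw [hn]; ring⟩
  intro x hx
  obtain ⟨n, hn⟩ := key x hx
  have hD : ContinuousOn (fun y => (f y - g y).im / (2 * Real.pi)) S :=
    (Complex.continuous_im.comp_continuousOn (hf.sub hg)).div_const _
  have hval : ∀ y ∈ S, ∀ m : ℤ, f y - g y = m * (2 * Real.pi * Complex.I) →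
      (f y - g y).im / (2 * Real.pi) = m := by
    intro y _ m hm
    rw [hm]
    simp [Real.pi_ne_zero]
  have hconn := (hS.image _ hD).ordConnected
  have hn0 : (n : ℝ) ∈ (fun y => (f y - g y).im / (2 * Real.pi)) '' S := ⟨x, hx, hval x hx n hn⟩
  have h00 : (0 : ℝ) ∈ (fun y => (f y - g y).im / (2 * Real.pi)) '' S :=
    ⟨x₀, hx₀, by simp [h₀]⟩
  have hhalf : ∀ c : ℝ, c ∈ (fun y => (f y - g y).im / (2 * Real.pi)) '' S →
      ∃ m : ℤ, c = m := by
    rintro c ⟨y, hy, rfl⟩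
    obtain ⟨m, hm⟩ := key y hy
    exact ⟨m, hval y hy m hm⟩
  have hn' : n = 0 := by
    rcases lt_trichotomy n 0 with h | h | h
    · exfalso
      have h1 : (n : ℝ) ≤ -1 := by exact_mod_cast Int.le_sub_one_of_lt h
      obtain ⟨m, hm⟩ := hhalf _ (hconn.out hn0 h00 (show (-(1 / 2) : ℝ) ∈ Icc (n : ℝ) 0 from
        ⟨by linarith, by norm_num⟩))
      have h2 : ((2 * m : ℤ) : ℝ) = ((-1 : ℤ) : ℝ) := by push_cast; linarith
      have h3 := Int.cast_injective h2
      omega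
    · exact h
    · exfalso
      have h1 : (1 : ℝ) ≤ n := by exact_mod_cast h
      obtain ⟨m, hm⟩ := hhalf _ (hconn.out h00 hn0 (show (1 / 2 : ℝ) ∈ Icc 0 (n : ℝ) from
        ⟨by norm_num, by linarith⟩))
      have h2 : ((2 * m : ℤ) : ℝ) = ((1 : ℤ) : ℝ) := by push_cast; linarith
      have h3 := Int.cast_injective h2
      omega
  simpa [hn', sub_eq_zero] using hn

/-- The difference quotient of a `C¹` curve extends continuously to the diagonal. -/
theorem exists_continuous_chord_slope {γ γ' : ℝ → ℂ} (hγ : ∀ t, HasDerivAt γ (γ' t) t)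
    (hγ' : Continuous γ') :
    ∃ F : ℝ × ℝ → ℂ, Continuous F ∧ (∀ s, F (s, s) = γ' s) ∧
      ∀ s t : ℝ, F (s, t) * ((t - s : ℝ) : ℂ) = γ t - γ s := by
  refine ⟨fun p => ∫ r in (0 : ℝ)..1, γ' (p.1 + (p.2 - p.1) * r), ?_, ?_, ?_⟩
  · exact intervalIntegral.continuous_parametric_intervalIntegral_of_continuous'
      (by simp only [Function.uncurry_def]; fun_prop) 0 1
  · intro s
    simp
  · intro s t
    have h := intervalIntegral.smul_integral_comp_add_mul γ' (a := 0) (b := 1) (t - s) s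
    have h2 := intervalIntegral.integral_eq_sub_of_hasDerivAt (fun x _ => hγ x)
      (hγ'.intervalIntegrable s t)
    simp only [mul_zero, add_zero, mul_one, add_sub_cancel] at h
    rw [← h2, ← h, Complex.real_smul, mul_comm]

theorem Convex.isSimplyConnected_s18 {E : Type*} [AddCommGroup E] [Module ℝ E] [TopologicalSpace E]
    [ContinuousAdd E] [ContinuousSMul ℝ E] {s : Set E} (hs : Convex ℝ s) (hne : s.Nonempty) :
    IsSimplyConnected s := by
  have := hs.contractibleSpace hne
  exact (inferInstance : SimplyConnectedSpace s)

theorem convex_abs_sub_lt (T : ℝ) : Convex ℝ {p : ℝ × ℝ | |p.2 - p.1| < T} := by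
  have h : {p : ℝ × ℝ | |p.2 - p.1| < T} =
      (LinearMap.snd ℝ ℝ ℝ - LinearMap.fst ℝ ℝ ℝ) ⁻¹' Metric.ball 0 T := by
    ext p; simp
  rw [h]
  exact (convex_ball _ _).linear_preimage _

theorem isOpen_abs_sub_lt (T : ℝ) : IsOpen {p : ℝ × ℝ | |p.2 - p.1| < T} :=
  isOpen_lt (by fun_prop) continuous_const

/-- A continuous logarithm of the chord slopes of a curve, extending a given logarithm of the
velocity. -/
theorem exists_chord_log {γ h : ℝ → ℂ} (hγ : ∀ t, HasDerivAt γ (Complex.exp (h t)) t)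
    (hh : Continuous h) {T : ℝ} (hT : 0 < T) (hinj : ∀ s t, s < t → t < s + T → γ s ≠ γ t) :
    ∃ L : ℝ × ℝ → ℂ, ContinuousOn L {p : ℝ × ℝ | |p.2 - p.1| < T} ∧ (∀ s, L (s, s) = h s) ∧
      ∀ s t : ℝ, |t - s| < T → Complex.exp (L (s, t)) * ((t - s : ℝ) : ℂ) = γ t - γ s := by
  obtain ⟨F, hFc, hFd, hF⟩ := exists_continuous_chord_slope hγ (Complex.continuous_exp.comp hh)
  have h00 : ∀ s : ℝ, (s, s) ∈ {p : ℝ × ℝ | |p.2 - p.1| < T} := by intro s; simpa using hT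
  have hsc := (convex_abs_sub_lt T).isSimplyConnected_s18 ⟨_, h00 0⟩
  have hne : (0 : ℂ) ∉ F '' {p : ℝ × ℝ | |p.2 - p.1| < T} := by
    rintro ⟨⟨s, t⟩, hp, h0⟩
    have hp : |t - s| < T := hp
    have h1 := hF s t
    rw [h0, zero_mul, eq_comm, sub_eq_zero] at h1
    rw [abs_lt] at hp
    rcases lt_trichotomy s t with h | h | h
    · exact hinj s t h (by linarith) h1.symm
    · subst h
      rw [hFd] at h0
      exact Complex.exp_ne_zero _ h0
    · exact hinj t s h (by linarith) h1
  obtain ⟨L, hLc, hL⟩ := Complex.exists_continuousOn_eqOn_exp_comp hsc (isOpen_abs_sub_lt T)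
    hFc.continuousOn hne
  have hLd : Continuous fun s => L (s, s) := by
    rw [← continuousOn_univ]
    exact hLc.comp (by fun_prop) fun s _ => h00 s
  have hLF : ∀ s t : ℝ, |t - s| < T → Complex.exp (L (s, t)) = F (s, t) := fun s t hst => hL hst
  have hc : Complex.exp (h 0 - L (0, 0)) = 1 := by
    rw [Complex.exp_sub, hLF 0 0 (h00 0), hFd]
    exact div_self (Complex.exp_ne_zero _)
  refine ⟨fun p => L p + (h 0 - L (0, 0)), hLc.add continuousOn_const, ?_, ?_⟩
  · intro s
    refine eqOn_of_exp_eqOn isPreconnected_univ (f := fun s => L (s, s) + (h 0 - L (0, 0)))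
      (hLd.add continuous_const).continuousOn hh.continuousOn ?_ (mem_univ 0) (by ring)
      (mem_univ s)
    intro s _
    rw [Complex.exp_add, hc, mul_one, hLF s s (h00 s), hFd]
  · intro s t hst
    rw [Complex.exp_add, hc, mul_one, hLF s t hst, hF]

/-- A regular closed plane curve whose velocity has a periodic logarithm is not simple. -/
theorem false_of_periodic {γ h : ℝ → ℂ} (hγ : ∀ t, HasDerivAt γ (Complex.exp (h t)) t)
    (hh : Continuous h) {T : ℝ} (hT : 0 < T) (hinj : ∀ s t, s < t → t < s + T → γ s ≠ γ t)
    (hγT : ∀ s, γ (s + T) = γ s) (hhT : h T = h 0) : False := by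
  obtain ⟨L, hLc, hLd, hL⟩ := exists_chord_log hγ hh hT hinj
  have hshift : EqOn (fun p : ℝ × ℝ => L (p.1 + T, p.2 + T)) L {p : ℝ × ℝ | |p.2 - p.1| < T} := by
    refine eqOn_of_exp_eqOn (convex_abs_sub_lt T).isPreconnected
      (hLc.comp (by fun_prop) fun p hp => ?_) hLc ?_ (x₀ := (0, 0)) (by simpa using hT)
      (by simpa [hLd] using hhT)
    · simpa using hp
    · rintro ⟨s, t⟩ hp
      have hp : |t - s| < T := hp
      have h1 := hL (s + T) (t + T) (by simpa using hp)
      have h2 := hL s t hp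
      rw [add_sub_add_right_eq_sub, hγT, hγT, ← h2] at h1
      rcases eq_or_ne s t with rfl | hst
      · simp only [hLd]
        have h3 := hγ (s + T)
        have h4 : HasDerivAt γ (Complex.exp (h (s + T))) s := by
          have := h3.comp_add_const s T
          exact this.congr_of_eventuallyEq (Eventually.of_forall fun x => (hγT x).symm)
        exact h4.unique (hγ s)
      · exact mul_right_cancel₀ (Complex.ofReal_ne_zero.2 (sub_ne_zero.2 hst.symm)) h1
  set f : ℝ → ℝ := fun s => (L (s + T / 2, s + T) - L (s, s + T / 2)).im with hf
  have hfc : Continuous f := by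
    refine Complex.continuous_im.comp (Continuous.sub ?_ ?_) <;> rw [← continuousOn_univ] <;>
      refine hLc.comp (by fun_prop) fun s _ => ?_
    · simp only [mem_ofPred_eq]; rw [abs_lt]; constructor <;> linarith
    · simp only [mem_ofPred_eq]; rw [abs_lt]; constructor <;> linarith
  have hf0 : ∀ s, f s ≠ 0 := by
    intro s hs
    have h1 := hL (s + T / 2) (s + T) (by rw [abs_lt]; constructor <;> linarith)
    have h2 := hL s (s + T / 2) (by rw [abs_lt]; constructor <;> linarith)
    rw [hγT] at h1
    have hT2 : ((T / 2 : ℝ) : ℂ) ≠ 0 := Complex.ofReal_ne_zero.2 (by positivity)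
    rw [show s + T - (s + T / 2) = T / 2 by ring] at h1
    rw [show s + T / 2 - s = T / 2 by ring] at h2
    have h3 : Complex.exp (L (s + T / 2, s + T)) = -Complex.exp (L (s, s + T / 2)) := by
      apply mul_right_cancel₀ hT2
      rw [neg_mul, h1, h2]; ring
    have h4 : Complex.exp (L (s + T / 2, s + T) - L (s, s + T / 2)) = -1 := by
      rw [Complex.exp_sub, h3, neg_div, div_self (Complex.exp_ne_zero _)]
    have h5 := congrArg Complex.re h4
    rw [Complex.exp_re, show (L (s + T / 2, s + T) - L (s, s + T / 2)).im = 0 from hs] at h5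
    have := Real.exp_pos (L (s + T / 2, s + T) - L (s, s + T / 2)).re
    simp at h5
    simp only [Complex.sub_re] at this
    linarith
  have hsum : f 0 + f (T / 2) = 0 := by
    have h1 := hshift (show ((0 : ℝ), T / 2) ∈ {p : ℝ × ℝ | |p.2 - p.1| < T} by
      simp only [mem_ofPred_eq]; rw [abs_lt]; constructor <;> linarith)
    simp only [hf, zero_add] at h1 ⊢
    rw [← Complex.add_im, show T / 2 + T / 2 = T by ring, show T / 2 + T = T + T / 2 by ring]
    rw [show T / 2 + T = T + T / 2 by ring] at h1
    rw [h1]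
    simp
  have hzero : (0 : ℝ) ∈ range f := by
    have hconn := (isPreconnected_range hfc).ordConnected
    rcases le_total (f 0) 0 with h | h
    · exact hconn.out ⟨0, rfl⟩ ⟨T / 2, rfl⟩ ⟨h, by linarith⟩
    · exact hconn.out ⟨T / 2, rfl⟩ ⟨0, rfl⟩ ⟨by linarith, h⟩
  obtain ⟨s, hs⟩ := hzero
  exact hf0 s hs

/-- A simple arc with a continuous logarithm of its velocity cannot return to a chord that is
nearly orthogonal to the velocity at both ends without meeting that chord in between. -/
theorem false_of_orthogonal_return {γ h : ℝ → ℂ}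
    (hγ : ∀ t, HasDerivAt γ (Complex.exp (h t)) t) (hh : Continuous h) {a b T : ℝ}
    (hab : a < b) (hbT : b - a < T) (hinj : ∀ s t, s < t → t < s + T → γ s ≠ γ t)
    (hseg : ∀ t ∈ Ioo a b, γ t ∉ openSegment ℝ (γ a) (γ b)) {w : ℂ} {r : ℝ}
    (hr : γ b - γ a = r * Complex.I * Complex.exp w)
    (ha : |(h a - w).im| < 1 / 4) (hb : |(h b - w).im| < 1 / 4) : False := by
  obtain ⟨L, hLc, hLd, hL⟩ := exists_chord_log hγ hh (by linarith : 0 < T) hinj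
  set f : ℝ → ℝ := fun t => Real.sin ((L (t, b) - L (a, t)).im / 2) with hf
  have hfc : ContinuousOn f (Icc a b) := by
    refine Real.continuous_sin.comp_continuousOn (ContinuousOn.div_const
      (Complex.continuous_im.comp_continuousOn (ContinuousOn.sub ?_ ?_)) _) <;>
      refine hLc.comp (by fun_prop) fun t ht => ?_
    · simp only [mem_ofPred_eq]; rw [abs_lt]; constructor <;> linarith [ht.1, ht.2]
    · simp only [mem_ofPred_eq]; rw [abs_lt]; constructor <;> linarith [ht.1, ht.2]
  have hprod : f a * f b < 0 := by
    have h1 := hL a b (by rw [abs_lt]; constructor <;> linarith)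
    rw [hr] at h1
    have h2 : Complex.exp (L (a, b) - w) * ((b - a : ℝ) : ℂ) = r * Complex.I := by
      rw [Complex.exp_sub, div_mul_eq_mul_div, h1, mul_div_assoc, div_self (Complex.exp_ne_zero _),
        mul_one]
    have h3 := congrArg Complex.re h2
    rw [Complex.re_mul_ofReal, Complex.re_ofReal_mul, Complex.I_re, mul_zero, Complex.exp_re] at h3
    have hcos : Real.cos (L (a, b) - w).im = 0 := by
      have h4 : b - a ≠ 0 := by linarith
      simpa [h4, Real.exp_ne_zero] using h3
    set φ := (L (a, b) - w).im with hφ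
    set α := (h a - w).im with hα
    set β := (h b - w).im with hβ
    have hfa : f a = Real.sin ((φ - α) / 2) := by
      simp only [hf, hLd, hφ, hα, Complex.sub_im]; ring_nf
    have hfb : f b = Real.sin ((β - φ) / 2) := by
      simp only [hf, hLd, hφ, hβ, Complex.sub_im]; ring_nf
    have hid : 2 * (f a * f b) =
        Real.sin φ * Real.sin ((α + β) / 2) - Real.cos ((β - α) / 2) := by
      have e1 : Real.cos (φ - (α + β) / 2) = Real.sin φ * Real.sin ((α + β) / 2) := by
        rw [Real.cos_sub, hcos]; ring
      rw [← e1, hfa, hfb, show φ - (α + β) / 2 = (φ - α) / 2 - (β - φ) / 2 by ring,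
        show (β - α) / 2 = (φ - α) / 2 + (β - φ) / 2 by ring, Real.cos_sub, Real.cos_add]
      ring
    rw [abs_lt] at ha hb
    have e2 : Real.sin φ * Real.sin ((α + β) / 2) ≤ 1 / 4 := by
      refine (le_abs_self _).trans ?_
      rw [abs_mul]
      have e3 : |Real.sin ((α + β) / 2)| ≤ |(α + β) / 2| := Real.abs_sin_le_abs
      have e4 : |(α + β) / 2| ≤ 1 / 4 := by rw [abs_le]; constructor <;> linarith
      nlinarith [Real.abs_sin_le_one φ, abs_nonneg (Real.sin φ),
        abs_nonneg (Real.sin ((α + β) / 2))]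
    have e5 := Real.one_sub_sq_div_two_le_cos (x := (β - α) / 2)
    nlinarith
  have hzero : ∃ t ∈ Icc a b, f t = 0 := by
    rcases mul_neg_iff.1 hprod with ⟨h1, h2⟩ | ⟨h1, h2⟩
    · exact intermediate_value_Icc' hab.le hfc ⟨h2.le, h1.le⟩
    · exact intermediate_value_Icc hab.le hfc ⟨h1.le, h2.le⟩
  obtain ⟨t, ht, hft⟩ := hzero
  have hta : t ≠ a := by rintro rfl; simp [hft] at hprod
  have htb : t ≠ b := by rintro rfl; simp [hft] at hprod
  have hat : a < t := lt_of_le_of_ne ht.1 hta.symm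
  have htb : t < b := lt_of_le_of_ne ht.2 htb
  obtain ⟨n, hn⟩ := Real.sin_eq_zero_iff.1 hft
  set z := L (t, b) - L (a, t) with hz
  have hexp : Complex.exp z = (Real.exp z.re : ℂ) := by
    rw [Complex.exp_eq_exp_re_mul_sin_add_cos, show z.im = n * (2 * Real.pi) by linarith,
      Complex.ofReal_exp]
    have c1 := Real.cos_int_mul_two_pi n
    have s1 : Real.sin (n * (2 * Real.pi)) = 0 := by
      rw [show (n : ℝ) * (2 * Real.pi) = ((2 * n : ℤ) : ℝ) * Real.pi by push_cast; ring]
      exact Real.sin_int_mul_pi _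
    rw [← Complex.ofReal_cos, ← Complex.ofReal_sin, c1, s1]
    simp
  have h1 := hL t b (by rw [abs_lt]; constructor <;> linarith)
  have h2 := hL a t (by rw [abs_lt]; constructor <;> linarith)
  rw [show L (t, b) = z + L (a, t) by rw [hz]; ring, Complex.exp_add, hexp] at h1
  have hpos := Real.exp_pos z.re
  set ρ := Real.exp z.re
  have hta' : 0 < t - a := by linarith
  have htb' : 0 < b - t := by linarith
  have hk : (γ b - γ t) * ((t - a : ℝ) : ℂ) = ((ρ * (b - t) : ℝ) : ℂ) * (γ t - γ a) := by
    rw [← h1, ← h2]; push_cast; ring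
  have hden : 0 < ρ * (b - t) + (t - a) := by positivity
  refine hseg t ⟨hat, htb⟩ ⟨ρ * (b - t) / (ρ * (b - t) + (t - a)),
    (t - a) / (ρ * (b - t) + (t - a)), by positivity, by positivity, by field_simp, ?_⟩
  have hden' : ((ρ * (b - t) + (t - a) : ℝ) : ℂ) ≠ 0 := Complex.ofReal_ne_zero.2 hden.ne'
  apply mul_left_cancel₀ hden'
  simp only [Complex.real_smul, Complex.ofReal_div]
  field_simp
  push_cast at hk ⊢
  linear_combination hk

/-- Two-sided escape estimate for a curve that is slow near `p`. -/
theorem norm_sub_le_of_slow {f f' : ℝ → ℂ} (hf : ∀ t, HasDerivAt f (f' t) t) {p : ℂ}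
    {ρ M : ℝ} (hM : 0 < M) (hslow : ∀ t, ‖f t - p‖ ≤ ρ → ‖f' t‖ < M)
    (h0 : ‖f 0 - p‖ ≤ ρ / 2) {t : ℝ} (ht : |t| ≤ ρ / (2 * M)) : ‖f t - p‖ ≤ ρ := by
  have fwd : ∀ {g g' : ℝ → ℂ}, (∀ t, HasDerivAt g (g' t) t) →
      (∀ t, ‖g t - p‖ ≤ ρ → ‖g' t‖ < M) → ‖g 0 - p‖ ≤ ρ / 2 →
      ∀ t, 0 ≤ t → t ≤ ρ / (2 * M) → ‖g t - p‖ ≤ ρ := by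
    intro g g' hg hs hg0 t ht0 ht1
    have hMt : ∀ s, s ≤ ρ / (2 * M) → ρ / 2 + M * s ≤ ρ := by
      intro s hs
      rw [le_div_iff₀ (by positivity)] at hs
      linarith
    refine (image_norm_le_of_norm_deriv_right_lt_deriv_boundary (a := 0) (b := ρ / (2 * M))
      (f := fun t => g t - p) (f' := g') (B := fun s => ρ / 2 + M * s) (B' := fun _ => M)
      ?_ ?_ ?_ ?_ ?_ ⟨ht0, ht1⟩).trans (hMt t ht1)
    · exact fun s _ => ((hg s).sub_const p).continuousAt.continuousWithinAt
    · exact fun s _ => ((hg s).sub_const p).hasDerivWithinAt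
    · simpa using hg0
    · intro s
      simpa using ((hasDerivAt_id s).const_mul M).const_add (ρ / 2)
    · intro s hs1 hs2
      exact hs s (hs2.le.trans (hMt s hs1.2.le))
  rw [abs_le] at ht
  rcases le_total 0 t with h | h
  · exact fwd hf hslow h0 t h ht.2
  · have h1 : ∀ s, HasDerivAt (fun s => f (-s)) (-f' (-s)) s := fun s => by
      have h2 := (hf (-s)).scomp s (hasDerivAt_neg s)
      rw [neg_one_smul] at h2
      exact h2
    have := fwd h1 (fun s hs => by simpa using hslow (-s) hs) (by simpa using h0) (-t)
      (by linarith) (by linarith)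
    simpa using this

/-- If a curve has velocity close to `v` whenever it is near `p`, then each time it comes very
close to `p` it soon crosses the line through `p` orthogonal to `v`. -/
theorem exists_crossing {f f' : ℝ → ℂ} (hf : ∀ t, HasDerivAt f (f' t) t) {p v : ℂ} (hv : v ≠ 0)
    {ρ : ℝ} (hρ : 0 < ρ) (hclose : ∀ t, ‖f t - p‖ ≤ ρ → ‖f' t - v‖ ≤ ‖v‖ / 2)
    {τ : ℝ} (hτ : ‖f τ - p‖ ≤ ρ / 8) :
    ∃ t, |t - τ| ≤ ρ / (4 * ‖v‖) ∧ ‖f t - p‖ ≤ ρ ∧ ((f t - p) / v).re = 0 := by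
  have hv' : 0 < ‖v‖ := norm_pos_iff.2 hv
  set η := ρ / (4 * ‖v‖) with hη
  have hηpos : 0 < η := by positivity
  have hstay : ∀ s, |s| ≤ η → ‖f (τ + s) - p‖ ≤ ρ := by
    intro s hs
    refine norm_sub_le_of_slow (f := fun s => f (τ + s)) (f' := fun s => f' (τ + s))
      (M := 2 * ‖v‖) (fun t => (hf (τ + t)).comp_const_add τ t) (by positivity) ?_ ?_ ?_
    · intro t ht
      have h1 := hclose _ ht
      have h2 := norm_sub_norm_le (f' (τ + t)) v
      linarith
    · simp only [add_zero]; linarith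
    · rw [show 2 * (2 * ‖v‖) = 4 * ‖v‖ by ring]; exact hs
  set u : ℝ → ℝ := fun s => ((f (τ + s) - p) / v).re with hu
  have hud : ∀ s, HasDerivAt u (f' (τ + s) / v).re s := fun s => by
    have h1 : HasDerivAt (fun s => (f (τ + s) - p) / v) (f' (τ + s) / v) s :=
      (((hf (τ + s)).comp_const_add τ s).sub_const p).div_const v
    exact (Complex.reCLM.hasFDerivAt.comp_hasDerivAt s h1)
  have hu' : ∀ s, |s| ≤ η → 1 / 2 ≤ (f' (τ + s) / v).re := by
    intro s hs
    have h1 := hclose _ (hstay s hs)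
    have h2 : ‖f' (τ + s) / v - 1‖ ≤ 1 / 2 := by
      rw [div_sub_one hv, norm_div, div_le_iff₀ hv']
      linarith
    have h3 := (abs_le.1 ((Complex.abs_re_le_norm _).trans h2)).1
    simp only [Complex.sub_re, Complex.one_re] at h3
    linarith
  have hu0 : |u 0| ≤ η / 2 := by
    refine (Complex.abs_re_le_norm _).trans ?_
    rw [norm_div, div_le_iff₀ hv', add_zero]
    refine hτ.trans (le_of_eq ?_)
    rw [hη]; field_simp; norm_num
  have huc : ContinuousOn u (Icc (-η) η) := fun s _ => (hud s).continuousAt.continuousWithinAt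
  have hmono : ∀ x ∈ Icc (-η) η, ∀ y ∈ Icc (-η) η, x ≤ y → 1 / 2 * (y - x) ≤ u y - u x := by
    refine (convex_Icc _ _).mul_sub_le_image_sub_of_le_deriv huc
      (fun s _ => (hud s).differentiableAt.differentiableWithinAt) fun s hs => ?_
    rw [(hud s).deriv]
    have hs' : s ∈ Icc (-η) η := interior_subset hs
    exact hu' s (abs_le.2 hs')
  rw [abs_le] at hu0
  have h1 := hmono (-η) ⟨le_rfl, by linarith⟩ 0 ⟨by linarith, hηpos.le⟩ (by linarith)
  have h2 := hmono 0 ⟨by linarith, hηpos.le⟩ η ⟨by linarith, le_rfl⟩ hηpos.le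
  obtain ⟨s, hs, hs0⟩ := intermediate_value_Icc (by linarith : -η ≤ η) huc
    (show (0 : ℝ) ∈ Icc (u (-η)) (u η) from ⟨by linarith, by linarith⟩)
  exact ⟨τ + s, by simpa using abs_le.2 hs, hstay s (abs_le.2 hs), hs0⟩

/-- If a curve meets a closed set at two times and leaves it at once after each visit, then it
has two consecutive visits. -/
theorem exists_consecutive {A : Set ℝ} (hA : IsClosed A) {a c : ℝ} (hc : c ∈ A)
    (hac : a < c) (hiso : ∀ᶠ t in 𝓝[>] a, t ∉ A) :
    ∃ b ∈ A, a < b ∧ ∀ t ∈ Ioo a b, t ∉ A := by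
  obtain ⟨e, he, hae⟩ := mem_nhdsGT_iff_exists_Ioo_subset.1 hiso
  have he : a < e := he
  obtain ⟨b, ⟨hb, hbA⟩, hmin⟩ := (isCompact_Icc.inter_right hA).exists_isLeast
    (s := Icc (min e c) c ∩ A) ⟨c, ⟨min_le_right _ _, le_rfl⟩, hc⟩
  refine ⟨b, hbA, lt_of_lt_of_le (lt_min he hac) hb.1, fun t ht htA => ?_⟩
  by_cases hte : t < min e c
  · exact hae ⟨ht.1, hte.trans_le (min_le_left _ _)⟩ htA
  · exact absurd (hmin ⟨⟨not_lt.1 hte, ht.2.le.trans hb.2⟩, htA⟩) (not_le.2 ht.2)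

/-- Orbits of a complete nonvanishing continuous planar vector field have no accumulation points:
the visits to a small disc around any point all happen within a bounded time interval. -/
theorem exists_radius_dist_le {X : ℂ → ℂ} (hX : Continuous X) (hX0 : ∀ p, X p ≠ 0)
    {Φ : ℝ → ℂ → ℂ} (hΦadd : ∀ s t x, Φ (s + t) x = Φ s (Φ t x))
    (hODE : ∀ t x, HasDerivAt (fun τ : ℝ => Φ τ x) (X (Φ t x)) t) (x p : ℂ) :
    ∃ δ > 0, ∃ C, ∀ s t, ‖Φ s x - p‖ ≤ δ → ‖Φ t x - p‖ ≤ δ → |s - t| ≤ C := by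
  obtain ⟨g, hgc, hg⟩ := Complex.exists_continuousOn_eqOn_exp_comp
    (convex_univ.isSimplyConnected_s18 univ_nonempty) isOpen_univ hX.continuousOn
    (by rintro ⟨z, -, hz⟩; exact hX0 z hz)
  rw [continuousOn_univ] at hgc
  have hg : ∀ z, Complex.exp (g z) = X z := fun z => hg (mem_univ z)
  obtain ⟨ρ, hρ, hρball⟩ : ∃ ρ > 0, ∀ z, ‖z - p‖ ≤ ρ →
      ‖X z - X p‖ ≤ ‖X p‖ / 2 ∧ ‖g z - g p‖ < 1 / 4 := by
    have h1 : ∀ᶠ z in 𝓝 p, ‖X z - X p‖ ≤ ‖X p‖ / 2 := by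
      have := (hX.tendsto p).eventually (Metric.closedBall_mem_nhds (X p)
        (half_pos (norm_pos_iff.2 (hX0 p))))
      simpa [dist_eq_norm] using this
    have h2 : ∀ᶠ z in 𝓝 p, ‖g z - g p‖ < 1 / 4 := by
      have := (hgc.tendsto p).eventually (Metric.ball_mem_nhds (g p) (show (0 : ℝ) < 1 / 4 by
        norm_num))
      simpa [dist_eq_norm] using this
    obtain ⟨ρ, hρ, h⟩ := Metric.nhds_basis_closedBall.eventually_iff.1 (h1.and h2)
    exact ⟨ρ, hρ, fun z hz => h (by simpa [dist_eq_norm] using hz)⟩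
  set γ : ℝ → ℂ := fun t => Φ t x with hγdef
  have hγX : ∀ t, HasDerivAt γ (X (γ t)) t := fun t => hODE t x
  have hγc : Continuous γ := continuous_iff_continuousAt.2 fun t => (hγX t).continuousAt
  have hγ : ∀ t, HasDerivAt γ (Complex.exp (g (γ t))) t := fun t => by rw [hg]; exact hγX t
  have hgγ : Continuous fun t => g (γ t) := hgc.comp hγc
  have hshift : ∀ s t u, γ s = γ t → γ (u + s) = γ (u + t) := by
    intro s t u hst
    simp only [hγdef] at hst ⊢
    rw [hΦadd, hΦadd, hst]
  set S : Set ℂ := {z | ‖z - p‖ ≤ ρ ∧ ((z - p) / X p).re = 0} with hS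
  have hScl : IsClosed S := by
    have h1 : Continuous fun z : ℂ => ‖z - p‖ := by fun_prop
    have h2 : Continuous fun z : ℂ => ((z - p) / X p).re :=
      Complex.continuous_re.comp ((continuous_id.sub continuous_const).div_const _)
    exact (isClosed_le h1 continuous_const).inter (isClosed_eq h2 continuous_const)
  have hScv : Convex ℝ S := by
    intro z hz y hy a b ha hb hab
    have h1 : a • z + b • y - p = a • (z - p) + b • (y - p) := by
      have : p = a • p + b • p := by rw [← add_smul, hab, one_smul]
      simp only [smul_sub]
      nth_rewrite 1 [this]
      ring
    constructor
    · rw [h1]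
      refine (norm_add_le _ _).trans ?_
      rw [norm_smul, norm_smul, Real.norm_of_nonneg ha, Real.norm_of_nonneg hb]
      nlinarith [hz.1, hy.1]
    · rw [h1, add_div, Complex.add_re, Complex.real_smul, Complex.real_smul, mul_div_assoc,
        mul_div_assoc, Complex.re_ofReal_mul, Complex.re_ofReal_mul, hz.2, hy.2]
      simp
  have hiso : ∀ a, γ a ∈ S → ∀ᶠ t in 𝓝[>] a, t ∉ γ ⁻¹' S := by
    intro a ha
    have h1 : HasDerivAt (fun t => (γ t - p) / X p) (X (γ a) / X p) a :=
      ((hγX a).sub_const p).div_const _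
    have h2 : HasDerivAt (fun t => ((γ t - p) / X p).re) (X (γ a) / X p).re a :=
      Complex.reCLM.hasFDerivAt.comp_hasDerivAt a h1
    have h3 : (X (γ a) / X p).re ≠ 0 := by
      have h4 : ‖X (γ a) / X p - 1‖ ≤ 1 / 2 := by
        rw [div_sub_one (hX0 p), norm_div, div_le_iff₀ (norm_pos_iff.2 (hX0 p))]
        linarith [(hρball _ ha.1).1]
      have h5 := (abs_le.1 ((Complex.abs_re_le_norm _).trans h4)).1
      simp only [Complex.sub_re, Complex.one_re] at h5
      linarith
    refine ((h2.eventually_ne h3 (c := 0)).filter_mono (nhdsGT_le_nhdsNE a)).mono ?_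
    exact fun t ht hts => ht hts.2
  have huniq : ∀ a c, γ a ∈ S → γ c ∈ S → a < c → False := by
    intro a c ha hc hac
    obtain ⟨b, hb, hab, hnot⟩ := exists_consecutive (hScl.preimage hγc) hc hac (hiso a ha)
    have hret : ∀ s t, γ s = γ t → γ (a + (t - s)) = γ a := by
      intro s t hst
      have := hshift s t (a - s) hst
      rw [show a - s + s = a by ring, show a - s + t = a + (t - s) by ring] at this
      exact this.symm
    have hinj : ∀ s t, s < t → t < s + (b - a) → γ s ≠ γ t := by
      intro s t hst hts h
      refine hnot (a + (t - s)) ⟨by linarith, by linarith⟩ ?_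
      rw [mem_preimage, hret s t h]
      exact ha
    by_cases hper : γ b = γ a
    · refine false_of_periodic hγ hgγ (sub_pos.2 hab) hinj (fun s => ?_) ?_
      · have := hshift b a (s - a) hper
        rwa [show s - a + b = s + (b - a) by ring, show s - a + a = s by ring] at this
      · have := hshift b a (-a) hper
        rw [show -a + b = b - a by ring, show -a + a = 0 by ring] at this
        simp only [this]
    · obtain ⟨ε, hε, hball⟩ := Metric.eventually_nhds_iff.1
        (hγc.continuousAt.eventually_ne hper)
      refine false_of_orthogonal_return hγ hgγ hab (T := b - a + ε) (by linarith) ?_ ?_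
        (w := g p) (r := ((γ b - γ a) / X p).im) ?_ ?_ ?_
      · intro s t hst hts h
        by_cases hlt : t < s + (b - a)
        · exact hinj s t hst hlt h
        · refine hball (y := a + (t - s)) ?_ (hret s t h)
          rw [Real.dist_eq, abs_lt]
          constructor <;> linarith
      · exact fun t ht htS => hnot t ht (hScv.openSegment_subset ha hb htS)
      · rw [hg, ← div_eq_iff (hX0 p)]
        refine Complex.ext ?_ (by simp)
        have : (γ b - γ a) / X p = (γ b - p) / X p - (γ a - p) / X p := by ring
        rw [this, Complex.sub_re, ha.2, hb.2]
        simp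
      · exact (Complex.abs_im_le_norm _).trans_lt (hρball _ ha.1).2
      · exact (Complex.abs_im_le_norm _).trans_lt (hρball _ hb.1).2
  refine ⟨ρ / 8, by positivity, 2 * (ρ / (4 * ‖X p‖)), fun s t hs ht => ?_⟩
  have hcross := fun {τ} => exists_crossing hγX (hX0 p) hρ
    (fun t ht => (hρball _ ht).1) (τ := τ)
  obtain ⟨a, ha1, ha2⟩ := hcross hs
  obtain ⟨b, hb1, hb2⟩ := hcross ht
  have hab : a = b := by
    rcases lt_trichotomy a b with h | h | h
    · exact (huniq a b ha2 hb2 h).elim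
    · exact h
    · exact (huniq b a hb2 ha2 h).elim
  subst hab
  rw [abs_le] at *
  constructor <;> linarith

/-- Integral curves of a smooth complete non-vanishing planar vector field are proper:
they meet every compact set in a compact set of times. -/
theorem stmt_18 (X : ℂ → ℂ) (hX : ContDiff ℝ (⊤ : ℕ∞) X) (hX0 : ∀ p, X p ≠ 0)
    (Φ : ℝ → ℂ → ℂ)
    (hΦ0 : ∀ x, Φ 0 x = x)
    (hΦadd : ∀ s t x, Φ (s + t) x = Φ s (Φ t x))
    (hODE : ∀ t x, HasDerivAt (fun τ : ℝ => Φ τ x) (X (Φ t x)) t) :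
    ∀ (x : ℂ) (K : Set ℂ), IsCompact K → IsCompact {t : ℝ | Φ t x ∈ K} := by
  intro x K hK
  have hc : Continuous fun t => Φ t x :=
    continuous_iff_continuousAt.2 fun t => (hODE t x).continuousAt
  refine Metric.isCompact_of_isClosed_isBounded (hK.isClosed.preimage hc) ?_
  refine hK.induction_on (p := fun s => Bornology.IsBounded {t : ℝ | Φ t x ∈ s})
    (by simp) (fun s t hst ht => ht.subset fun u hu => hst hu) (fun s t hs ht => hs.union ht) ?_
  intro p _
  obtain ⟨δ, hδ, C, hC⟩ := exists_radius_dist_le hX.continuous hX0 hΦadd hODE x p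
  refine ⟨Metric.closedBall p δ, mem_nhdsWithin_of_mem_nhds (Metric.closedBall_mem_nhds p hδ),
    Metric.isBounded_iff.2 ⟨C, fun s hs t ht => hC s t ?_ ?_⟩⟩
  · simpa [dist_eq_norm] using hs
  · simpa [dist_eq_norm] using ht
end
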